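/- arXiv:1707.02473 — 4 statements merged into one kernel-verified Lean document; each statement's English description precedes it below -/
import Mathlib

section
/- Let G be a 2-connected fairly cubic graph in which the two vertices of degree 2 are adjacent. Then G is matching-decyclable if and only if G is Hamiltonian. -/
open SimpleGraph

/-- `M` is a matching contained in the edge set of `G`. -/
def IsMatchingIn {V : Type*} (G : SimpleGraph V) (M : Set (Sym2 V)) : Prop :=
  M ⊆ G.edgeSet ∧ ∀ e ∈ M, ∀ f ∈ M, e ≠ f → ∀ v : V, v ∈ e → v ∉ f

/-- `G` is matching-decyclable: some matching `M ⊆ E(G)` has `G - M` acyclic. -/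
def MDecyclable {V : Type*} (G : SimpleGraph V) : Prop :=
  ∃ M : Set (Sym2 V), IsMatchingIn G M ∧ (G.deleteEdges M).IsAcyclic

/-- `G` is sparse: every nonempty subgraph `H` satisfies `|E(H)| ≤ ⌊3|V(H)|/2⌋ - 1`. -/
def Sparse {V : Type*} (G : SimpleGraph V) : Prop :=
  ∀ H : G.Subgraph, H.verts.Nonempty →
    Nat.card H.edgeSet ≤ 3 * Nat.card H.verts / 2 - 1

/-- A graph is 2-connected: connected, at least 3 vertices, and no cut vertex. -/
def TwoConnected {V : Type*} (G : SimpleGraph V) : Prop :=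
  G.Connected ∧ 3 ≤ Nat.card V ∧
    ∀ v : V, (((⊤ : G.Subgraph).deleteVerts {v}).coe).Connected

/-- `G` is fairly cubic: exactly two vertices of degree 2, the rest of degree 3. -/
def FairlyCubic {V : Type*} [Fintype V] (G : SimpleGraph V) [DecidableRel G.Adj] : Prop :=
  Nat.card {v : V // G.degree v = 2} = 2 ∧ ∀ v : V, G.degree v = 2 ∨ G.degree v = 3

def diamondGraph : SimpleGraph (Fin 4) :=
  SimpleGraph.fromEdgeSet {s(0,1), s(0,2), s(0,3), s(1,2), s(2,3)}

def triangleGraph : SimpleGraph (Fin 3) := ⊤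

def gemGraph : SimpleGraph (Fin 5) :=
  SimpleGraph.fromEdgeSet {s(0,1), s(1,2), s(2,3), s(0,4), s(1,4), s(2,4), s(3,4)}

def houseGraph : SimpleGraph (Fin 5) :=
  SimpleGraph.fromEdgeSet {s(0,1), s(1,2), s(2,3), s(0,3), s(0,4), s(1,4)}

def dominoGraph : SimpleGraph (Fin 6) :=
  SimpleGraph.fromEdgeSet {s(0,1), s(1,2), s(2,3), s(0,3), s(1,4), s(4,5), s(2,5)}

/-- `K_{3,3}` minus one edge. -/
def K33minus : SimpleGraph (Fin 3 ⊕ Fin 3) :=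
  SimpleGraph.fromEdgeSet
    {e ∈ (completeBipartiteGraph (Fin 3) (Fin 3)).edgeSet | e ≠ s(Sum.inl 0, Sum.inr 0)}

/-- `G` contains `H` as a (not necessarily induced) subgraph. -/
def ContainsSub {V W : Type*} (G : SimpleGraph V) (H : SimpleGraph W) : Prop :=
  ∃ B : G.Subgraph, Nonempty (B.coe ≃g H)

/-- Chordal: no induced cycle of length at least 4. -/
def Chordal {V : Type*} (G : SimpleGraph V) : Prop :=
  ∀ n : ℕ, 4 ≤ n → IsEmpty (SimpleGraph.cycleGraph n ↪g G)

/-- Distance-hereditary: no induced house, hole, domino, or gem. -/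
def DistHereditary {V : Type*} (G : SimpleGraph V) : Prop :=
  IsEmpty (houseGraph ↪g G) ∧ IsEmpty (dominoGraph ↪g G) ∧ IsEmpty (gemGraph ↪g G) ∧
    ∀ n : ℕ, 5 ≤ n → IsEmpty (SimpleGraph.cycleGraph n ↪g G)

/-- `v` is a cut vertex of `G`. -/
def IsCutVertex {V : Type*} (G : SimpleGraph V) (v : V) : Prop :=
  G.Connected ∧ ¬ (((⊤ : G.Subgraph).deleteVerts {v}).coe).Connected

/-- A block of `G`: either (the subgraph spanned by) a bridge, or a maximal
2-connected subgraph. -/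
def IsBlock {V : Type*} (G : SimpleGraph V) (B : G.Subgraph) : Prop :=
  (∃ u w : V, G.IsBridge s(u, w) ∧ B.verts = {u, w} ∧ B.edgeSet = {s(u, w)}) ∨
  (TwoConnected B.coe ∧ ∀ B' : G.Subgraph, B ≤ B' → TwoConnected B'.coe → B' = B)

/-- A leaf block: a block containing exactly one cut vertex of `G`. -/
def IsLeafBlock {V : Type*} (G : SimpleGraph V) (B : G.Subgraph) : Prop :=
  IsBlock G B ∧ ∃! v : V, v ∈ B.verts ∧ IsCutVertex G v

/-- A chain: a connected graph with exactly two leaf blocks, whose leaf blocks are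
diamonds and whose non-leaf blocks are triangles. -/
def IsChainGraph {V : Type*} (G : SimpleGraph V) : Prop :=
  G.Connected ∧
  Nat.card {B : G.Subgraph // IsLeafBlock G B} = 2 ∧
  (∀ B : G.Subgraph, IsLeafBlock G B → Nonempty (B.coe ≃g diamondGraph)) ∧
  (∀ B : G.Subgraph, IsBlock G B → ¬ IsLeafBlock G B → Nonempty (B.coe ≃g triangleGraph))

lemma IsMatchingIn.degree_le_degree_deleteEdges_add_one {V : Type*} {G : SimpleGraph V}
    {M : Set (Sym2 V)} (hM : IsMatchingIn G M) (w : V) [Fintype (G.neighborSet w)]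
    [Fintype ((G.deleteEdges M).neighborSet w)] :
    G.degree w ≤ (G.deleteEdges M).degree w + 1 := by
  classical
  have h : (G.neighborFinset w \ (G.deleteEdges M).neighborFinset w).card ≤ 1 := by
    refine Finset.card_le_one.mpr fun a ha b hb ↦ ?_
    simp only [Finset.mem_sdiff, mem_neighborFinset, deleteEdges_adj, not_and, not_not] at ha hb
    by_contra hab
    exact hM.2 _ (ha.2 ha.1) _ (hb.2 hb.1) (mt Sym2.congr_right.mp hab) w (by simp) (by simp)
  have := Finset.card_le_card_sdiff_add_card (s := G.neighborFinset w)
    (t := (G.deleteEdges M).neighborFinset w)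
  simp only [card_neighborFinset_eq_degree] at this
  lia

lemma mDecyclable_of_le_of_isAcyclic {V : Type*} {G T : SimpleGraph V} [G.LocallyFinite]
    [T.LocallyFinite] (hle : T ≤ G) (hT : T.IsAcyclic)
    (hdeg : ∀ w, G.degree w ≤ T.degree w + 1) : MDecyclable G := by
  classical
  refine ⟨G.edgeSet \ T.edgeSet, ⟨Set.sdiff_subset, ?_⟩, ?_⟩
  · intro e he f hf hef w hwe hwf
    obtain ⟨a, rfl⟩ := Sym2.mem_iff_exists.mp hwe
    obtain ⟨b, rfl⟩ := Sym2.mem_iff_exists.mp hwf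
    simp only [Set.mem_sdiff, mem_edgeSet] at he hf
    have hab : a ≠ b := fun h ↦ hef (h ▸ rfl)
    have hsub : insert a (insert b (T.neighborFinset w)) ⊆ G.neighborFinset w := by
      intro x hx
      simp only [Finset.mem_insert, mem_neighborFinset] at hx ⊢
      rcases hx with rfl | rfl | hx
      exacts [he.1, hf.1, hle hx]
    have := Finset.card_le_card hsub
    rw [Finset.card_insert_of_notMem (by simp [hab, he.2]),
      Finset.card_insert_of_notMem (by simp [hf.2])] at this
    simp only [card_neighborFinset_eq_degree] at this
    have := hdeg w
    lia
  · convert hT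
    ext a b
    have := @hle a b
    simp only [deleteEdges_adj, Set.mem_sdiff, mem_edgeSet]
    tauto

lemma SimpleGraph.Walk.IsPath.isHamiltonian_of_degree_le {V : Type*} [Fintype V] [DecidableEq V]
    {T : SimpleGraph V} [DecidableRel T.Adj] (hT : T.Connected) {u v : V} (huv : u ≠ v)
    {p : T.Walk u v} (hp : p.IsPath) (hu : T.degree u ≤ 1) (hv : T.degree v ≤ 1)
    (hdeg : ∀ w, T.degree w ≤ 2) : p.IsHamiltonian := by
  refine hp.isHamiltonian_of_mem fun w ↦ ?_
  by_contra hw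
  obtain ⟨q⟩ := hT.preconnected u w
  obtain ⟨⟨⟨x, y⟩, hxy⟩, -, hx, hy⟩ :=
    q.exists_boundary_dart {z | z ∈ p.support} (by simp) hw
  simp only [Set.mem_ofPred_eq] at hx hy hxy
  have hlt : (p.toSubgraph.neighborSet x).ncard < T.degree x := by
    rw [← card_neighborSet_eq_degree, ← Nat.card_eq_fintype_card, Nat.card_coe_set_eq]
    refine Set.ncard_lt_ncard ⟨p.toSubgraph.neighborSet_subset x, fun h ↦ hy ?_⟩
    exact p.mem_verts_toSubgraph.mp (p.toSubgraph.edge_vert (h hxy).symm)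
  have hnil : ¬ p.Nil := fun h ↦ huv h.eq
  obtain ⟨i, rfl, hi⟩ := Walk.mem_support_iff_exists_getVert.mp hx
  rcases Nat.eq_zero_or_pos i with rfl | hpos
  · rw [Walk.getVert_zero, hp.neighborSet_toSubgraph_startpoint hnil, Set.ncard_singleton] at hlt
    lia
  · rcases hi.eq_or_lt with rfl | hi
    · rw [Walk.getVert_length, hp.neighborSet_toSubgraph_endpoint hnil,
        Set.ncard_singleton] at hlt
      lia
    · rw [hp.ncard_neighborSet_toSubgraph_internal_eq_two hpos.ne' hi] at hlt
      have := hdeg (p.getVert i)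
      lia

lemma FairlyCubic.sum_degrees_add_two {V : Type*} [Fintype V] {G : SimpleGraph V}
    [DecidableRel G.Adj] (hf : FairlyCubic G) :
    ∑ w, G.degree w + 2 = 3 * Fintype.card V := by
  have h2 : ∑ w, (if G.degree w = 2 then 1 else 0) = 2 := by
    rw [← Finset.card_filter, ← Fintype.card_subtype, ← Nat.card_eq_fintype_card, hf.1]
  nth_rw 1 [← h2]
  rw [← Finset.sum_add_distrib, Finset.sum_congr rfl (g := fun _ ↦ 3)]
  · simp [mul_comm]
  · intro w _
    rcases hf.2 w with h | h <;> simp [h]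

lemma SimpleGraph.IsAcyclic.isTree_of_card_le {V : Type*} [Fintype V] {T : SimpleGraph V}
    [Nonempty V] [Fintype T.edgeSet] (hT : T.IsAcyclic)
    (hcard : Fintype.card V ≤ T.edgeFinset.card + 1) : T.IsTree := by
  classical
  obtain ⟨F, hTF, -, hF⟩ :=
    (connected_top (V := V)).exists_isTree_le_of_le_of_isAcyclic le_top hT
  have hcF := hF.card_edgeFinset
  have heq : T.edgeFinset = F.edgeFinset :=
    Finset.eq_of_subset_of_card_le (edgeFinset_subset_edgeFinset.mpr hTF) (by lia)
  rwa [edgeFinset_inj.mp heq]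

/-- In a fairly cubic graph, removing a decycling matching leaves a spanning tree, and the
matching is perfect. -/
lemma FairlyCubic.isTree_deleteEdges {V : Type*} [Fintype V] [DecidableEq V] [Nonempty V]
    {G : SimpleGraph V} [DecidableRel G.Adj] (hf : FairlyCubic G) {M : Set (Sym2 V)}
    [DecidableRel (G.deleteEdges M).Adj] (hM : IsMatchingIn G M)
    (hac : (G.deleteEdges M).IsAcyclic) :
    (G.deleteEdges M).IsTree ∧ ∀ w, (G.deleteEdges M).degree w + 1 = G.degree w := by
  have hle (w) := hM.degree_le_degree_deleteEdges_add_one w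
  have hsumG := hf.sum_degrees_add_two
  have hsumT := (G.deleteEdges M).sum_degrees_eq_twice_card_edges
  have hsum : ∑ w, ((G.deleteEdges M).degree w + 1) =
      2 * (G.deleteEdges M).edgeFinset.card + Fintype.card V := by
    simp [Finset.sum_add_distrib, hsumT]
  have hsumle := Finset.sum_le_sum fun w (_ : w ∈ Finset.univ) ↦ hle w
  have htree := hac.isTree_of_card_le (by lia)
  have hcard := htree.card_edgeFinset
  refine ⟨htree, fun w ↦ ?_⟩
  exact ((Finset.sum_eq_sum_iff_of_le fun w _ ↦ hle w).mp (by lia) w (Finset.mem_univ w)).symm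

lemma FairlyCubic.exists_pair {V : Type*} [Fintype V] {G : SimpleGraph V} [DecidableRel G.Adj]
    (hf : FairlyCubic G) :
    ∃ u v, u ≠ v ∧ G.degree u = 2 ∧ G.degree v = 2 ∧ ∀ w, w ≠ u → w ≠ v → G.degree w = 3 := by
  classical
  have h := hf.1
  rw [Nat.card_eq_fintype_card, Fintype.card_subtype, Finset.card_eq_two] at h
  obtain ⟨u, v, huv, h⟩ := h
  simp only [Finset.ext_iff, Finset.mem_filter_univ, Finset.mem_insert,
    Finset.mem_singleton] at h
  exact ⟨u, v, huv, (h u).mpr (.inl rfl), (h v).mpr (.inr rfl), fun w hu hv ↦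
    (hf.2 w).resolve_left fun hw ↦ ((h w).mp hw).elim hu hv⟩

/-- A spanning path of a graph whose endpoints are adjacent closes up to a Hamiltonian cycle. -/
lemma SimpleGraph.Walk.IsHamiltonian.isHamiltonian_of_adj {V : Type*} [Fintype V] [DecidableEq V]
    {G : SimpleGraph V} {u v : V} {p : G.Walk u v} (hp : p.IsHamiltonian) (hvu : G.Adj v u)
    (hcard : 3 ≤ Fintype.card V) : G.IsHamiltonian := by
  refine fun _ ↦ ⟨v, .cons hvu p, Walk.isHamiltonianCycle_iff_isCycle_and_length_eq.mpr ⟨?_, ?_⟩⟩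
  · refine (Walk.cons_isCycle_iff p hvu).mpr ⟨hp.isPath, fun he ↦ ?_⟩
    have hlen := hp.length_eq
    have := hp.isPath.length_eq_one_of_mem_edges (Sym2.eq_swap ▸ he)
    lia
  · rw [Walk.length_cons, hp.length_eq]
    lia

lemma FairlyCubic.isHamiltonian_of_mDecyclable {V : Type*} [Fintype V] [DecidableEq V]
    {G : SimpleGraph V} [DecidableRel G.Adj] (hf : FairlyCubic G)
    (hadj : ∀ u v : V, u ≠ v → G.degree u = 2 → G.degree v = 2 → G.Adj u v)
    (hcard : 3 ≤ Fintype.card V) (h : MDecyclable G) : G.IsHamiltonian := by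
  classical
  obtain ⟨M, hM, hac⟩ := h
  obtain ⟨u, v, huv, hu, hv, -⟩ := hf.exists_pair
  have : Nonempty V := ⟨u⟩
  obtain ⟨htree, hdeg⟩ := hf.isTree_deleteEdges hM hac
  obtain ⟨p, hp⟩ := htree.connected.exists_isPath u v
  have hham := hp.isHamiltonian_of_degree_le htree.connected huv
    (by have := hdeg u; lia) (by have := hdeg v; lia)
    (fun w ↦ by have := hdeg w; have := hf.2 w; lia)
  exact (hham.map (.ofLE (deleteEdges_le M)) Function.bijective_id).isHamiltonian_of_adj
    (hadj v u huv.symm hv hu) hcard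

lemma FairlyCubic.mDecyclable_of_isHamiltonian {V : Type*} [Fintype V] [DecidableEq V]
    {G : SimpleGraph V} [DecidableRel G.Adj] (hf : FairlyCubic G)
    (hadj : ∀ u v : V, u ≠ v → G.degree u = 2 → G.degree v = 2 → G.Adj u v)
    (h : G.IsHamiltonian) : MDecyclable G := by
  classical
  obtain ⟨u, v, huv, hu, hv, hw⟩ := hf.exists_pair
  have : Nontrivial V := ⟨u, v, huv⟩
  obtain ⟨p, hp⟩ := h.exists_isHamiltonianCycle u
  set C := p.toSubgraph.spanningCoe
  have hCG : C ≤ G := p.toSubgraph.spanningCoe_le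
  have hCdeg (w) : C.degree w = 2 := by
    rw [← card_neighborSet_eq_degree, ← Nat.card_eq_fintype_card, Nat.card_coe_set_eq]
    exact hp.isCycle.ncard_neighborSet_toSubgraph_eq_two (hp.mem_support w)
  have hmem (e) : e ∈ p.edges → e ∈ C.edgeSet := by
    induction e with | _ a b => exact Walk.adj_toSubgraph_iff_mem_edges.mpr
  have hCuv : C.Adj u v := by
    have heq : C.neighborFinset u = G.neighborFinset u :=
      Finset.eq_of_subset_of_card_le (fun x ↦ by simpa using @hCG u x) (by simp [hCdeg, hu])
    rw [← mem_neighborFinset, heq, mem_neighborFinset]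
    exact hadj u v huv hu hv
  let q : C.Walk u u := p.transfer C hmem
  have hq : q.IsHamiltonianCycle := by
    rw [Walk.isHamiltonianCycle_iff_isCycle_and_length_eq]
    exact ⟨hp.isCycle.transfer hmem, by rw [Walk.length_transfer, hp.length_eq]⟩
  have hCconn : C.Connected := IsHamiltonian.connected fun _ ↦ ⟨u, q, hq⟩
  have hbr : ¬ C.IsBridge s(u, v) := fun hb ↦ hb.notMem_edges_of_isCycle hq.isCycle
    (by rw [Walk.edges_transfer]; exact Walk.adj_toSubgraph_iff_mem_edges.mp hCuv)
  have hTconn := hCconn.connected_delete_edge_of_not_isBridge hbr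
  have hCcard : C.edgeFinset.card = Fintype.card V := by
    have := C.sum_degrees_eq_twice_card_edges
    simp only [hCdeg, Finset.sum_const, Finset.card_univ, smul_eq_mul] at this
    lia
  have hT : (C.deleteEdges {s(u, v)}).IsTree := by
    refine isTree_iff_connected_and_card.mpr ⟨hTconn, ?_⟩
    rw [edgeSet_deleteEdges, Nat.card_coe_set_eq,
      Set.ncard_sdiff_singleton_add_one (C.mem_edgeSet.mpr hCuv), ← coe_edgeFinset, Set.ncard_coe_finset, hCcard, Nat.card_eq_fintype_card]
  refine mDecyclable_of_le_of_isAcyclic ((deleteEdges_le _).trans hCG) hT.isAcyclic fun w ↦ ?_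
  by_cases hwuv : w = u ∨ w = v
  · have hM : IsMatchingIn C {s(u, v)} := by
      refine ⟨by simpa using hCuv, ?_⟩
      rintro e rfl f rfl hef
      exact absurd rfl hef
    have := hM.degree_le_degree_deleteEdges_add_one w
    rw [hCdeg] at this
    rcases hwuv with rfl | rfl <;> lia
  · rw [not_or] at hwuv
    have heq : (C.deleteEdges {s(u, v)}).neighborFinset w = C.neighborFinset w := by
      ext x
      simp [deleteEdges_adj, hwuv.1, hwuv.2]
    rw [hw w hwuv.1 hwuv.2, ← card_neighborFinset_eq_degree, heq, card_neighborFinset_eq_degree,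
      hCdeg]


theorem stmt10 {V : Type*} [Fintype V] [DecidableEq V] (G : SimpleGraph V)
    [DecidableRel G.Adj] (h2 : TwoConnected G) (hf : FairlyCubic G)
    (hadj : ∀ u v : V, u ≠ v → G.degree u = 2 → G.degree v = 2 → G.Adj u v) :
    MDecyclable G ↔ G.IsHamiltonian := by
  have hcard : 3 ≤ Fintype.card V := Nat.card_eq_fintype_card (α := V) ▸ h2.2.1
  exact ⟨hf.isHamiltonian_of_mDecyclable hadj hcard, hf.mDecyclable_of_isHamiltonian hadj⟩
end

section
/- A chain with k triangle blocks (k ≥ 0) has 2k + 7 vertices and 3k + 10 edges; in particular, every chain is a bad graph (|E| > ⌊(3/2)|V|⌋ − 1) and hence no chain is matching-decyclable. -/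
open SimpleGraph

namespace SimpleGraph.Subgraph

variable {V : Type*} {G : SimpleGraph V}

/-- Deleting a vertex commutes with coercing a subgraph to a graph on its vertex set. -/
def deleteVertsCoeIso (B : G.Subgraph) (v : B.verts) :
    ((⊤ : B.coe.Subgraph).deleteVerts {v}).coe ≃g (B.deleteVerts {(v : V)}).coe where
  toFun x := ⟨x.1.1, x.1.2, fun h => x.2.2 (Subtype.ext h)⟩
  invFun x := ⟨⟨x.1, x.2.1⟩, trivial, fun h => x.2.2 (congrArg Subtype.val h)⟩
  left_inv _ := rfl
  right_inv _ := rfl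
  map_rel_iff' := by
    rintro ⟨⟨a, ha⟩, -, ha'⟩ ⟨⟨b, hb⟩, -, hb'⟩
    simp only [Set.mem_singleton_iff, Subtype.ext_iff] at ha' hb'
    simp [ha, hb, ha', hb', Subtype.ext_iff]

theorem twoConnected_coe_iff {B : G.Subgraph} :
    TwoConnected B.coe ↔ B.Connected ∧ 3 ≤ Nat.card B.verts ∧
      ∀ v ∈ B.verts, (B.deleteVerts {v}).Connected := by
  simp only [TwoConnected, Subgraph.connected_iff', (deleteVertsCoeIso B _).connected_iff,
    Subtype.forall]

theorem deleteVerts_connected_of_twoConnected {B : G.Subgraph} (hB : TwoConnected B.coe) (v : V) :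
    (B.deleteVerts {v}).Connected := by
  rw [twoConnected_coe_iff] at hB
  by_cases hv : v ∈ B.verts
  · exact hB.2.2 v hv
  · rw [← deleteVerts_inter_verts_left_eq, Set.inter_singleton_eq_empty.2 hv, deleteVerts_empty]
    exact hB.1

theorem deleteVerts_sup_le (H K : G.Subgraph) (s : Set V) :
    H.deleteVerts s ⊔ K.deleteVerts s ≤ (H ⊔ K).deleteVerts s :=
  sup_le (deleteVerts_mono le_sup_left) (deleteVerts_mono le_sup_right)

theorem twoConnected_sup [Finite V] {H K : G.Subgraph} (hH : TwoConnected H.coe)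
    (hK : TwoConnected K.coe) (hHK : (H.verts ∩ K.verts).Nontrivial) :
    TwoConnected (H ⊔ K).coe := by
  refine twoConnected_coe_iff.2 ⟨?_, ?_, fun v _ => ?_⟩
  · exact connected_sup (twoConnected_coe_iff.1 hH).1.preconnected
      (twoConnected_coe_iff.1 hK).1.preconnected hHK.nonempty
  · exact hH.2.1.trans (Nat.card_mono (Set.toFinite _) Set.subset_union_left)
  · obtain ⟨w, hw, hwv⟩ := hHK.exists_ne v
    refine (connected_sup (deleteVerts_connected_of_twoConnected hH v).preconnected
      (deleteVerts_connected_of_twoConnected hK v).preconnected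
      ⟨w, ⟨hw.1, hwv⟩, ⟨hw.2, hwv⟩⟩).mono (deleteVerts_sup_le H K {v}) ?_
    simp [Set.union_sdiff_distrib]

theorem twoConnected_toSubgraph_of_isCycle [Finite V] {u : V} {c : G.Walk u u} (hc : c.IsCycle) :
    TwoConnected c.toSubgraph.coe := by
  classical
  refine twoConnected_coe_iff.2 ⟨c.toSubgraph_connected, ?_, fun v hv => ?_⟩
  · have h : c.support.tail.toFinset.card = c.length := by
      rw [List.toFinset_card_of_nodup hc.support_nodup]; simp
    have h' : (c.support.tail.toFinset : Set V) ⊆ c.toSubgraph.verts := fun x hx => by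
      rw [Walk.mem_verts_toSubgraph]
      exact List.mem_of_mem_tail (List.mem_toFinset.1 hx)
    have h'' := Nat.card_mono (Set.toFinite _) h'
    rw [Nat.card_coe_set_eq, Set.ncard_coe_finset, h] at h''
    exact hc.three_le_length.trans h''
  · rw [Walk.mem_verts_toSubgraph] at hv
    rw [← c.toSubgraph_rotate hv]
    have hc' := hc.rotate hv
    generalize c.rotate v hv = d at hc'
    cases d with
    | nil => exact absurd hc' Walk.not_isCycle_nil
    | @cons _ w _ h p =>
      obtain ⟨hp, -⟩ := (Walk.cons_isCycle_iff p h).1 hc'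
      have hn : ¬ p.Nil := fun hn => h.ne hn.eq.symm
      have hs : p.dropLast.support = p.support.dropLast := p.support_dropLast hn
      have hcat := p.dropLast_support_concat
      have hnd := hp.support_nodup
      rw [← hcat] at hnd
      have hverts : p.dropLast.toSubgraph.verts =
          ((Walk.cons h p).toSubgraph.deleteVerts {v}).verts := by
        ext x
        have hx : x ∈ p.support ↔ x ∈ p.support.dropLast ∨ x = v := by
          conv_lhs => rw [← hcat, List.mem_append, List.mem_singleton]
        have hv' : v ∉ p.support.dropLast := by
          intro h'
          grind
        simp only [Walk.verts_toSubgraph, hs, deleteVerts_verts, Walk.support_cons, List.mem_cons,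
          Set.mem_ofPred_eq, Set.mem_sdiff, Set.mem_singleton_iff, hx]
        grind
      refine p.dropLast.toSubgraph_connected.mono ⟨hverts.le, fun a b hab => ?_⟩ hverts
      have ha : a ∈ p.dropLast.toSubgraph.verts := edge_vert _ hab
      have hb : b ∈ p.dropLast.toSubgraph.verts := edge_vert _ hab.symm
      rw [hverts] at ha hb
      refine deleteVerts_adj.2 ⟨ha.1, ha.2, hb.1, hb.2, ?_⟩
      rw [Walk.adj_toSubgraph_iff_mem_edges] at hab ⊢
      rw [Walk.edges_cons]
      refine List.mem_cons_of_mem _ ?_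
      rw [Walk.dropLast, Walk.edges_take] at hab
      exact List.mem_of_mem_take hab

end SimpleGraph.Subgraph

section Blocks

variable {V : Type*} {G : SimpleGraph V}

/-- A maximal 2-connected subgraph absorbs 2-connected subgraphs meeting it in two vertices. -/
theorem le_of_maximal_twoConnected [Finite V] {B C : G.Subgraph} (hB : TwoConnected B.coe)
    (hmax : ∀ B' : G.Subgraph, B ≤ B' → TwoConnected B'.coe → B' = B)
    (hC : TwoConnected C.coe) (h : (B.verts ∩ C.verts).Nontrivial) : C ≤ B :=
  le_sup_right.trans (hmax _ le_sup_left (Subgraph.twoConnected_sup hB hC h)).le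

theorem nontrivial_inter_verts_of_mem_edgeSet {B C : G.Subgraph} {e : Sym2 V}
    (hB : e ∈ B.edgeSet) (hC : e ∈ C.edgeSet) : (B.verts ∩ C.verts).Nontrivial := by
  induction e with
  | h u v =>
    exact ⟨u, ⟨B.edge_vert hB, C.edge_vert hC⟩, v,
      ⟨B.edge_vert hB.symm, C.edge_vert hC.symm⟩, (B.adj_sub hB).ne⟩

theorem exists_isBlock_mem_edgeSet [Finite V] {e : Sym2 V} (he : e ∈ G.edgeSet) :
    ∃ B : G.Subgraph, IsBlock G B ∧ e ∈ B.edgeSet := by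
  by_cases hb : G.IsBridge e
  · induction e with
    | h u v =>
      have hadj : G.Adj u v := he
      exact ⟨G.subgraphOfAdj hadj, .inl ⟨u, v, hb, by simp, by simp⟩, by simp⟩
  · rw [isBridge_iff_forall_cycle_notMem he] at hb
    push Not at hb
    obtain ⟨u, c, hc, hec⟩ := hb
    obtain ⟨B, hcB, hB⟩ := (Set.toFinite {B : G.Subgraph | TwoConnected B.coe}).exists_le_maximal
      (Subgraph.twoConnected_toSubgraph_of_isCycle hc)
    exact ⟨B, .inr ⟨hB.1, fun B' h h' => (hB.2 h' h).antisymm h⟩,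
      Subgraph.edgeSet_mono hcB ((c.mem_edges_toSubgraph).2 hec)⟩

/-- In a spanning tree, the edges inside a maximal 2-connected subgraph form a spanning tree of
that subgraph. -/
theorem card_edgeSet_inter_isTree [Finite V] {T : SimpleGraph V} (hT : T.IsTree) (hTG : T ≤ G)
    {B : G.Subgraph} (hB : TwoConnected B.coe)
    (hmax : ∀ B' : G.Subgraph, B ≤ B' → TwoConnected B'.coe → B' = B) :
    (T.edgeSet ∩ B.edgeSet).ncard + 1 = Nat.card B.verts := by
  classical
  let S : T.Subgraph :=
    { verts := B.verts
      Adj := fun u v => T.Adj u v ∧ B.Adj u v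
      adj_sub := fun h => h.1
      edge_vert := fun h => B.edge_vert h.2
      symm := ⟨fun _ _ h => ⟨h.1.symm, h.2.symm⟩⟩ }
  have hadj : ∀ a b : B.verts, B.coe.Adj a b → S.coe.Reachable a b := by
    intro a b hab
    have hab' : B.Adj a b := hab
    by_cases hTab : T.Adj a b
    · exact Adj.reachable (G := S.coe) ⟨hTab, hab'⟩
    obtain ⟨p, hp⟩ := hT.connected.exists_isPath (a : V) b
    have hcyc : (Walk.cons (B.adj_sub hab').symm (p.mapLe hTG)).IsCycle := by
      rw [Walk.cons_isCycle_iff]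
      refine ⟨hp.mapLe hTG, fun h => hTab ?_⟩
      rw [Walk.edges_mapLe_eq_edges] at h
      exact (p.edges_subset_edgeSet h).symm
    have hle := le_of_maximal_twoConnected hB hmax
      (Subgraph.twoConnected_toSubgraph_of_isCycle hcyc)
      (nontrivial_inter_verts_of_mem_edgeSet (e := s((b : V), (a : V)))
        hab'.symm (by simp))
    have hpS : p.toSubgraph ≤ S := by
      refine ⟨fun x hx => hle.1 ?_, fun x y hxy => ⟨p.toSubgraph.adj_sub hxy, hle.2 ?_⟩⟩
      · rw [Walk.mem_verts_toSubgraph] at hx ⊢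
        simp [hx]
      · rw [Walk.adj_toSubgraph_iff_mem_edges] at hxy ⊢
        rw [Walk.edges_cons, Walk.edges_mapLe_eq_edges]
        exact List.mem_cons_of_mem _ hxy
    exact (p.mapToSubgraph.map (Subgraph.inclusion hpS)).reachable
  have hconn : S.coe.Connected := by
    have : Nonempty S.verts := hB.1.nonempty
    refine ⟨fun a b => ?_⟩
    obtain ⟨w⟩ := hB.1.preconnected a b
    induction w with
    | nil => exact Reachable.refl _
    | cons h _ ih => exact (hadj _ _ h).trans ih
  have hS : S.coe.IsTree := ⟨hconn, hT.isAcyclic.subgraph S⟩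
  have hcard := (isTree_iff_connected_and_card.1 hS).2
  have himg : T.edgeSet ∩ B.edgeSet = Sym2.map Subtype.val '' S.coe.edgeSet := by
    rw [Subgraph.image_coe_edgeSet_coe]
    ext e
    induction e with
    | h u v => rfl
  rw [himg, Set.ncard_image_of_injective _ (Sym2.map.injective Subtype.val_injective)]
  exact hcard

/-- If blocks pairwise share no edges, they split every set of edges. -/
theorem ncard_eq_sum_ncard_inter_block [Finite V] [Fintype {B : G.Subgraph // IsBlock G B}]
    (hdisj : ∀ B C : G.Subgraph, IsBlock G B → IsBlock G C →
      (B.edgeSet ∩ C.edgeSet).Nonempty → B = C)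
    {S : Set (Sym2 V)} (hS : S ⊆ G.edgeSet) :
    S.ncard = ∑ B : {B : G.Subgraph // IsBlock G B}, (S ∩ B.1.edgeSet).ncard := by
  have hU : S = ⋃ B : {B : G.Subgraph // IsBlock G B}, S ∩ B.1.edgeSet := by
    ext e
    simp only [Set.mem_iUnion, Set.mem_inter_iff, exists_and_left]
    refine ⟨fun h => ⟨h, ?_⟩, fun h => h.1⟩
    obtain ⟨B, hB, he⟩ := exists_isBlock_mem_edgeSet (hS h)
    exact ⟨⟨B, hB⟩, he⟩
  conv_lhs => rw [hU]
  rw [Set.ncard_iUnion_of_finite (fun _ => Set.toFinite _), finsum_eq_sum_of_fintype]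
  intro B C hBC
  refine Set.disjoint_left.2 fun e h h' => hBC (Subtype.ext ?_)
  exact hdisj _ _ B.2 C.2 ⟨e, h.2, h'.2⟩

end Blocks

section Matching

variable {V : Type*} {G : SimpleGraph V}

theorem IsMatchingIn.two_mul_ncard_le [Fintype V] {M : Set (Sym2 V)} (hM : IsMatchingIn G M) :
    2 * M.ncard ≤ Fintype.card V := by
  classical
  rw [Set.ncard_eq_toFinset_card', mul_comm]
  refine le_trans (le_of_eq ?_) (Finset.card_le_univ (M.toFinset.biUnion Sym2.toFinset))
  rw [Finset.card_biUnion, Finset.sum_const_nat]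
  · intro e he
    exact Sym2.card_toFinset_of_not_isDiag _
      (G.not_isDiag_of_mem_edgeSet (hM.1 (by simpa using he)))
  · intro e he f hf hef
    refine Finset.disjoint_left.2 fun v hv hv' => ?_
    exact hM.2 e (by simpa using he) f (by simpa using hf) hef v (by simpa using hv)
      (by simpa using hv')

theorem SimpleGraph.IsAcyclic.ncard_edgeSet_lt [Fintype V] [Nonempty V] {F : SimpleGraph V}
    (hF : F.IsAcyclic) : F.edgeSet.ncard < Fintype.card V := by
  obtain ⟨T, hFT, -, hT⟩ :=
    (connected_top (V := V)).exists_isTree_le_of_le_of_isAcyclic le_top hF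
  have h := (isTree_iff_connected_and_card.1 hT).2
  have h' := Set.ncard_le_ncard (edgeSet_mono hFT) (Set.toFinite _)
  rw [Nat.card_coe_set_eq, Nat.card_eq_fintype_card] at h
  omega

/-- A graph with more edges than a forest and a matching have together is not
matching-decyclable. -/
theorem not_mDecyclable_of_card_lt [Fintype V] [Nonempty V]
    (h : 3 * Fintype.card V / 2 - 1 < Nat.card G.edgeSet) : ¬ MDecyclable G := by
  rintro ⟨M, hM, hF⟩
  have h₁ := hM.two_mul_ncard_le
  have h₂ := hF.ncard_edgeSet_lt
  rw [edgeSet_deleteEdges] at h₂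
  have h₃ := Set.ncard_sdiff_add_ncard_of_subset hM.1
  rw [Nat.card_coe_set_eq] at h
  omega

end Matching

theorem ncard_edgeSet_of_iso {V W : Type*} {G : SimpleGraph V} {B : G.Subgraph}
    {H : SimpleGraph W} (f : B.coe ≃g H) : B.edgeSet.ncard = Nat.card H.edgeSet := by
  rw [← Subgraph.image_coe_edgeSet_coe,
    Set.ncard_image_of_injective _ (Sym2.map.injective Subtype.val_injective)]
  exact Nat.card_congr f.mapEdgeSet

theorem card_edgeSet_diamondGraph : Nat.card diamondGraph.edgeSet = 5 := by
  have h : diamondGraph.edgeSet =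
      (({s(0,1), s(0,2), s(0,3), s(1,2), s(2,3)} : Finset (Sym2 (Fin 4))) : Set _) := by
    ext e
    simp only [diamondGraph, edgeSet_fromEdgeSet, Set.mem_sdiff, Set.mem_insert_iff,
      Set.mem_singleton_iff, Finset.coe_insert, Finset.coe_singleton, and_iff_left_iff_imp]
    rintro (rfl | rfl | rfl | rfl | rfl) <;> simp
  rw [h, Nat.card_coe_set_eq, Set.ncard_coe_finset]
  decide

theorem card_edgeSet_triangleGraph : Nat.card triangleGraph.edgeSet = 3 := by
  classical
  rw [triangleGraph, Nat.card_eq_fintype_card, ← edgeFinset_card,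
    card_edgeFinset_top_eq_card_choose_two]
  rfl

theorem IsChainGraph.card_of_card_block {V : Type*} [Fintype V] {G : SimpleGraph V}
    (hG : IsChainGraph G) {k : ℕ}
    (hk : Nat.card {B : G.Subgraph // IsBlock G B ∧ ¬ IsLeafBlock G B} = k) :
    Fintype.card V = 2 * k + 7 ∧ Nat.card G.edgeSet = 3 * k + 10 := by
  classical
  obtain ⟨hconn, hleaf, hdia, htri⟩ := hG
  have hverts : ∀ B : G.Subgraph, IsBlock G B →
      Nat.card B.verts = if IsLeafBlock G B then 4 else 3 := by
    intro B hB
    split_ifs with h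
    · obtain ⟨f⟩ := hdia B h
      simpa using Nat.card_congr f.toEquiv
    · obtain ⟨f⟩ := htri B hB h
      simpa using Nat.card_congr f.toEquiv
  have hedges : ∀ B : G.Subgraph, IsBlock G B →
      B.edgeSet.ncard = if IsLeafBlock G B then 5 else 3 := by
    intro B hB
    split_ifs with h
    · obtain ⟨f⟩ := hdia B h
      rw [ncard_edgeSet_of_iso f, card_edgeSet_diamondGraph]
    · obtain ⟨f⟩ := htri B hB h
      rw [ncard_edgeSet_of_iso f, card_edgeSet_triangleGraph]
  have htwo : ∀ B : G.Subgraph, IsBlock G B → TwoConnected B.coe ∧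
      ∀ B' : G.Subgraph, B ≤ B' → TwoConnected B'.coe → B' = B := by
    rintro B hB
    refine hB.resolve_left ?_
    rintro ⟨u, w, -, hv, -⟩
    have h := hverts B hB
    rw [hv, Nat.card_coe_set_eq] at h
    have := Set.ncard_insert_le u {w}
    rw [Set.ncard_singleton] at this
    split_ifs at h <;> omega
  have hdisj : ∀ B C : G.Subgraph, IsBlock G B → IsBlock G C →
      (B.edgeSet ∩ C.edgeSet).Nonempty → B = C := by
    rintro B C hB hC ⟨e, heB, heC⟩
    obtain ⟨hB₁, hB₂⟩ := htwo B hB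
    obtain ⟨hC₁, hC₂⟩ := htwo C hC
    exact (le_of_maximal_twoConnected hC₁ hC₂ hB₁
      (nontrivial_inter_verts_of_mem_edgeSet heC heB)).antisymm
      (le_of_maximal_twoConnected hB₁ hB₂ hC₁ (nontrivial_inter_verts_of_mem_edgeSet heB heC))
  have : Fintype {B : G.Subgraph // IsBlock G B} := Fintype.ofFinite _
  have hsum : ∀ a b : ℕ, ∑ B : {B : G.Subgraph // IsBlock G B},
      (if IsLeafBlock G B.1 then a else b) = 2 * a + k * b := by
    intro a b
    rw [Finset.sum_ite, Finset.sum_const, Finset.sum_const, smul_eq_mul, smul_eq_mul,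
      ← Fintype.card_subtype, ← Fintype.card_subtype, ← Nat.card_eq_fintype_card,
      ← Nat.card_eq_fintype_card, ← hleaf, ← hk,
      Nat.card_congr (Equiv.subtypeSubtypeEquivSubtypeInter (IsBlock G) (IsLeafBlock G)),
      Nat.card_congr (Equiv.subtypeSubtypeEquivSubtypeInter (IsBlock G) (¬ IsLeafBlock G ·)),
      Nat.card_congr (Equiv.subtypeEquivRight fun B : G.Subgraph =>
        and_iff_right_of_imp (fun h : IsLeafBlock G B => h.1))]
  obtain ⟨T, hTG, hT⟩ := hconn.exists_isTree_le
  have hTcard := (isTree_iff_connected_and_card.1 hT).2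
  rw [Nat.card_coe_set_eq, ncard_eq_sum_ncard_inter_block hdisj (edgeSet_mono hTG),
    Finset.sum_congr rfl (g := fun B => if IsLeafBlock G B.1 then 3 else 2) fun B _ => by
      have h := card_edgeSet_inter_isTree hT hTG (htwo B.1 B.2).1 (htwo B.1 B.2).2
      rw [hverts B.1 B.2] at h
      split_ifs at h ⊢ <;> omega,
    hsum, Nat.card_eq_fintype_card] at hTcard
  refine ⟨by omega, ?_⟩
  rw [Nat.card_coe_set_eq, ncard_eq_sum_ncard_inter_block hdisj subset_rfl,
    Finset.sum_congr rfl (g := fun B => if IsLeafBlock G B.1 then 5 else 3) fun B _ => by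
      rw [Set.inter_eq_right.2 B.1.edgeSet_subset, hedges B.1 B.2],
    hsum]
  omega

theorem stmt11 {V : Type*} [Fintype V] (G : SimpleGraph V)
    (hG : IsChainGraph G) (k : ℕ)
    (hk : Nat.card {B : G.Subgraph // IsBlock G B ∧ ¬ IsLeafBlock G B} = k) :
    Fintype.card V = 2 * k + 7 ∧ Nat.card G.edgeSet = 3 * k + 10 ∧
    3 * Fintype.card V / 2 - 1 < Nat.card G.edgeSet ∧ ¬ MDecyclable G := by
  obtain ⟨hV, hE⟩ := hG.card_of_card_block hk
  have : Nonempty V := hG.1.nonempty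
  have hbad : 3 * Fintype.card V / 2 - 1 < Nat.card G.edgeSet := by omega
  exact ⟨hV, hE, hbad, not_mDecyclable_of_card_lt hbad⟩
end

section
/- Let G be a sparse distance-hereditary graph and let C be a cycle of G. Then the subgraph of G induced by the vertex set of C is a triangle, a square (chordless 4-cycle), a diamond, or K_{3,3} minus an edge. -/
open SimpleGraph

/-- `f 0, f 1, ..., f (n - 1)` are the successive vertices of a cycle of length `n` in `G`. -/
structure CycleSeq {V : Type*} (G : SimpleGraph V) (n : ℕ) (f : ℕ → V) : Prop where
  three_le : 3 ≤ n
  inj : ∀ i j, i < n → j < n → f i = f j → i = j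
  adj : ∀ i, i + 1 < n → G.Adj (f i) (f (i + 1))
  adj_last : G.Adj (f (n - 1)) (f 0)

namespace CycleSeq

variable {V : Type*} {G : SimpleGraph V} {n : ℕ} {f : ℕ → V}

theorem of_isCycle {v : V} {c : G.Walk v v} (hc : c.IsCycle) :
    CycleSeq G c.length c.getVert where
  three_le := hc.three_le_length
  inj i j hi hj h := hc.getVert_injOn' (by simp; omega) (by simp; omega) h
  adj i hi := c.adj_getVert_succ (by omega)
  adj_last := by
    have h3 := hc.three_le_length
    have h := c.adj_getVert_succ (i := c.length - 1) (by omega)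
    rw [show c.length - 1 + 1 = c.length by omega, c.getVert_length] at h
    rwa [c.getVert_zero]

theorem rotate (h : CycleSeq G n f) (a : ℕ) (ha : a < n) :
    CycleSeq G n (fun k => f (if k + a < n then k + a else k + a - n)) where
  three_le := h.three_le
  inj i j hi hj e := by
    have h3 := h.three_le
    have := h.inj _ _ (by split_ifs <;> omega) (by split_ifs <;> omega) e
    split_ifs at this <;> omega
  adj i hi := by
    have h3 := h.three_le
    by_cases h1 : i + 1 + a < n
    · simp only [h1, show i + a < n by omega, if_true]
      rw [show i + 1 + a = i + a + 1 by omega]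
      exact h.adj _ (by omega)
    · by_cases h2 : i + a < n
      · simp only [h1, h2, if_true, if_false]
        rw [show i + a = n - 1 by omega, show i + 1 + a - n = 0 by omega]
        exact h.adj_last
      · simp only [h1, h2, if_false]
        rw [show i + 1 + a - n = i + a - n + 1 by omega]
        exact h.adj _ (by omega)
  adj_last := by
    have h3 := h.three_le
    rcases Nat.eq_zero_or_pos a with rfl | h0
    · simpa [show n - 1 < n by omega, show 0 < n by omega] using h.adj_last
    · simp only [show ¬ n - 1 + a < n by omega, show 0 + a < n by omega, if_true, if_false]
      have := h.adj (a - 1) (by omega)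
      rw [show a - 1 + 1 = a by omega] at this
      rwa [show n - 1 + a - n = a - 1 by omega, Nat.zero_add]

/-- The cycle cut off by a chord, avoiding `f 0` when `0 < i`. -/
theorem inner (h : CycleSeq G n f) {i j : ℕ} (hij : i + 2 ≤ j) (hj : j < n)
    (hadj : G.Adj (f i) (f j)) : CycleSeq G (j - i + 1) (fun k => f (i + k)) where
  three_le := by omega
  inj a b ha hb e := by have := h.inj _ _ (by omega) (by omega) e; omega
  adj a ha := h.adj (i + a) (by omega)
  adj_last := by
    simpa [show i + (j - i) = j by omega] using hadj.symm

/-- The cycle cut off by a chord on the side opposite to `inner`. -/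
theorem outer (h : CycleSeq G n f) {i j : ℕ} (hij : i + 2 ≤ j) (hj : j < n) (hd : j - i + 2 ≤ n)
    (hadj : G.Adj (f i) (f j)) :
    CycleSeq G (n - (j - i) + 1) (fun k => f (if k ≤ i then k else k + (j - i) - 1)) where
  three_le := by omega
  inj a b ha hb e := by
    have := h.inj _ _ (by split_ifs <;> omega) (by split_ifs <;> omega) e
    split_ifs at this <;> omega
  adj a ha := by
    by_cases h1 : a + 1 ≤ i
    · simp only [h1, show a ≤ i by omega, if_true]
      exact h.adj a (by omega)
    · by_cases h2 : a ≤ i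
      · simp only [h1, h2, if_true, if_false]
        rwa [show a = i by omega, show i + 1 + (j - i) - 1 = j by omega]
      · simp only [h1, h2, if_false]
        rw [show a + 1 + (j - i) - 1 = a + (j - i) - 1 + 1 by omega]
        exact h.adj _ (by omega)
  adj_last := by
    simp only [show ¬ n - (j - i) + 1 - 1 ≤ i by omega, Nat.zero_le, if_true, if_false]
    rw [show n - (j - i) + 1 - 1 + (j - i) - 1 = n - 1 by omega]
    exact h.adj_last

theorem card_le (h : CycleSeq G n f) (hs : Sparse G) (S : Finset (ℕ × ℕ))
    (hS : ∀ p ∈ S, p.1 < p.2 ∧ p.2 < n ∧ G.Adj (f p.1) (f p.2)) : S.card ≤ 3 * n / 2 - 1 := by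
  have h3 := h.three_le
  let H : G.Subgraph := (⊤ : G.Subgraph).induce (f '' Set.Iio n)
  have hinj : Set.InjOn f (Set.Iio n) := fun a ha b hb => h.inj a b ha hb
  have hv : Nat.card H.verts = n := by
    change Nat.card (f '' Set.Iio n) = n
    rw [Nat.card_image_of_injOn hinj]
    simp
  have hle := hs H ⟨f 0, 0, by simp; omega, rfl⟩
  rw [hv] at hle
  refine le_trans ?_ hle
  have hfin : H.edgeSet.Finite := by
    have : (f '' Set.Iio n).Finite := (Set.finite_Iio n).image f
    refine ((this.prod this).image fun p => s(p.1, p.2)).subset ?_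
    intro e
    induction e using Sym2.ind with
    | _ x y =>
      intro he
      exact ⟨(x, y), ⟨H.edge_vert he, H.edge_vert he.symm⟩, rfl⟩
  have : Finite H.edgeSet := hfin
  have hmem : ∀ p ∈ S, s(f p.1, f p.2) ∈ H.edgeSet := fun p hp => by
    obtain ⟨h1, h2, h4⟩ := hS p hp
    exact ⟨⟨p.1, by simp; omega, rfl⟩, ⟨p.2, by simpa using h2, rfl⟩, h4⟩
  rw [← Nat.card_eq_finsetCard S]
  refine Nat.card_le_card_of_injective (fun p : S => (⟨_, hmem p.1 p.2⟩ : H.edgeSet)) ?_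
  rintro ⟨⟨a, b⟩, hp⟩ ⟨⟨a', b'⟩, hp'⟩ e
  obtain ⟨h1, h2, -⟩ := hS _ hp
  obtain ⟨h1', h2', -⟩ := hS _ hp'
  simp only [Subtype.mk.injEq, Sym2.eq_iff] at e h1 h2 h1' h2'
  simp only [Subtype.mk.injEq, Prod.mk.injEq]
  rcases e with ⟨e1, e2⟩ | ⟨e1, e2⟩
  · exact ⟨h.inj _ _ (by omega) (by omega) e1, h.inj _ _ (by omega) (by omega) e2⟩
  · have := h.inj _ _ (by omega) (by omega) e1
    have := h.inj _ _ (by omega) (by omega) e2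
    omega

/-- A cycle of length at least 5 in a graph without holes has a chord. -/
theorem exists_chord (h : CycleSeq G n f) (hn : 5 ≤ n) (hdh : DistHereditary G) :
    ∃ i j, i + 2 ≤ j ∧ j < n ∧ j - i + 2 ≤ n ∧ G.Adj (f i) (f j) := by
  by_contra! hno
  have key : ∀ i j, i < j → j < n → (G.Adj (f i) (f j) ↔ j = i + 1 ∨ (i = 0 ∧ j = n - 1)) := by
    intro i j hij hj
    constructor
    · intro ha
      by_contra hc
      exact hno i j (by omega) hj (by omega) ha
    · rintro (rfl | ⟨rfl, rfl⟩)
      · exact h.adj i hj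
      · exact h.adj_last.symm
  refine (hdh.2.2.2 n hn).false ⟨⟨fun x => f x, fun x y e => Fin.ext (h.inj _ _ x.2 y.2 e)⟩, ?_⟩
  intro x y
  change G.Adj (f x) (f y) ↔ _
  rw [SimpleGraph.cycleGraph_adj']
  obtain ⟨x, hx⟩ := x
  obtain ⟨y, hy⟩ := y
  simp only [Fin.sub_def]
  rcases lt_trichotomy x y with hxy | rfl | hxy
  · rw [key x y hxy hy, Nat.mod_eq_of_lt (show n - y + x < n by omega),
      show n - x + y = y - x + n by omega, Nat.add_mod_right, Nat.mod_eq_of_lt (by omega)]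
    omega
  · rw [show n - x + x = n by omega]
    simp
  · rw [G.adj_comm, key y x hxy hx, Nat.mod_eq_of_lt (show n - x + y < n by omega),
      show n - y + x = x - y + n by omega, Nat.add_mod_right, Nat.mod_eq_of_lt (by omega)]
    omega

theorem mem_of_card_le (h : CycleSeq G n f) (hs : Sparse G) (S : Finset (ℕ × ℕ))
    (hS : ∀ p ∈ S, p.1 < p.2 ∧ p.2 < n ∧ G.Adj (f p.1) (f p.2)) (hc : 3 * n / 2 - 1 ≤ S.card)
    {i j : ℕ} (hij : i < j) (hj : j < n) (hadj : G.Adj (f i) (f j)) : (i, j) ∈ S := by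
  by_contra hmem
  have := h.card_le hs (insert (i, j) S) (by
    intro p hp
    rcases Finset.mem_insert.1 hp with rfl | hp
    · exact ⟨hij, hj, hadj⟩
    · exact hS p hp)
  rw [Finset.card_insert_of_notMem hmem] at this
  omega

theorem adj_iff_of_lt {W : Type*} {H : SimpleGraph W} {σ : W → ℕ}
    (hσ : Function.Injective σ)
    (hadj : ∀ a b, σ a < σ b → (G.Adj (f (σ a)) (f (σ b)) ↔ H.Adj a b)) (a b : W) :
    G.Adj (f (σ a)) (f (σ b)) ↔ H.Adj a b := by
  rcases lt_trichotomy (σ a) (σ b) with hab | hab | hab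
  · exact hadj a b hab
  · obtain rfl := hσ hab
    simp
  · rw [G.adj_comm, H.adj_comm]
    exact hadj b a hab

theorem nonempty_embedding {W : Type*} {H : SimpleGraph W} (h : CycleSeq G n f) (σ : W → ℕ)
    (hσ : Function.Injective σ) (hlt : ∀ a, σ a < n)
    (hadj : ∀ a b, σ a < σ b → (G.Adj (f (σ a)) (f (σ b)) ↔ H.Adj a b)) : Nonempty (H ↪g G) :=
  ⟨⟨⟨fun a => f (σ a), fun a b e => hσ (h.inj _ _ (hlt a) (hlt b) e)⟩,
    fun {a b} => adj_iff_of_lt hσ hadj a b⟩⟩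

theorem nonempty_iso {W : Type*} {H : SimpleGraph W} (h : CycleSeq G n f) (σ : W → ℕ)
    (hσ : Function.Injective σ) (hlt : ∀ a, σ a < n) (hsurj : ∀ k < n, ∃ a, σ a = k)
    (hadj : ∀ a b, σ a < σ b → (G.Adj (f (σ a)) (f (σ b)) ↔ H.Adj a b)) :
    Nonempty (G.induce (f '' Set.Iio n) ≃g H) := by
  let g : W → (f '' Set.Iio n : Set V) := fun a => ⟨f (σ a), σ a, hlt a, rfl⟩
  have hg : Function.Bijective g := by
    constructor
    · intro a b e
      exact hσ (h.inj _ _ (hlt a) (hlt b) (congrArg Subtype.val e))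
    · rintro ⟨_, k, hk, rfl⟩
      obtain ⟨a, rfl⟩ := hsurj k hk
      exact ⟨a, rfl⟩
  exact ⟨(⟨Equiv.ofBijective g hg, fun {a b} => adj_iff_of_lt hσ hadj a b⟩ :
    H ≃g G.induce (f '' Set.Iio n)).symm⟩

theorem five_not_adj (h : CycleSeq G 5 f) (hs : Sparse G) (hdh : DistHereditary G) :
    ¬ G.Adj (f 0) (f 2) := by
  intro h02
  have hT := fun i j => h.mem_of_card_le hs {(0, 1), (1, 2), (2, 3), (3, 4), (0, 4), (0, 2)}
    (by simp [h.adj 0, h.adj 1, h.adj 2, h.adj 3, h.adj_last.symm, h02]) (by decide)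
    (i := i) (j := j)
  have h01 := h.adj 0 (by omega)
  have h12 := h.adj 1 (by omega)
  have h23 := h.adj 2 (by omega)
  have h34 := h.adj 3 (by omega)
  have h04 := h.adj_last.symm
  have h03 : ¬ G.Adj (f 0) (f 3) := fun e => by simpa using hT 0 3 (by omega) (by omega) e
  have h13 : ¬ G.Adj (f 1) (f 3) := fun e => by simpa using hT 1 3 (by omega) (by omega) e
  have h14 : ¬ G.Adj (f 1) (f 4) := fun e => by simpa using hT 1 4 (by omega) (by omega) e
  have h24 : ¬ G.Adj (f 2) (f 4) := fun e => by simpa using hT 2 4 (by omega) (by omega) e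
  refine not_isEmpty_iff.2 (h.nonempty_embedding ![0, 2, 3, 4, 1] (by decide) (by decide) ?_) hdh.1
  intro a b
  fin_cases a <;> fin_cases b <;> simp [houseGraph, *]

theorem ne_five (h : CycleSeq G n f) (hs : Sparse G) (hdh : DistHereditary G) : n ≠ 5 := by
  rintro rfl
  obtain ⟨i, j, hij, hj, hd, hadj⟩ := h.exists_chord le_rfl hdh
  obtain rfl | rfl : j = i + 2 ∨ j = i + 3 := by omega
  · refine (h.rotate i (by omega)).five_not_adj hs hdh ?_
    simpa [show i < 5 by omega, hj, add_comm 2 i] using hadj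
  · refine (h.rotate (i + 3) hj).five_not_adj hs hdh ?_
    simpa [hj, show ¬ 2 + (i + 3) < 5 by omega, show 2 + (i + 3) - 5 = i by omega] using hadj.symm

theorem six_chord (h : CycleSeq G 6 f) (hs : Sparse G) (hdh : DistHereditary G) {i j : ℕ}
    (hij : i + 2 ≤ j) (hj : j < 6) (hd : j - i + 2 ≤ 6) (hadj : G.Adj (f i) (f j)) :
    j = i + 3 := by
  have h1 := (h.inner hij hj hadj).ne_five hs hdh
  have h2 := (h.outer hij hj hd hadj).ne_five hs hdh
  omega

theorem six_adj (h : CycleSeq G 6 f) (hs : Sparse G) (hdh : DistHereditary G)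
    (h14 : ¬ G.Adj (f 1) (f 4)) : G.Adj (f 2) (f 5) := by
  by_contra h25
  have hc := fun i j => h.six_chord hs hdh (i := i) (j := j)
  have h03 : G.Adj (f 0) (f 3) := by
    obtain ⟨i, j, hij, hj, hd, hadj⟩ := h.exists_chord (by omega) hdh
    obtain rfl := hc i j hij hj hd hadj
    have : i < 3 := by omega
    interval_cases i <;> simp_all
  have h01 := h.adj 0 (by omega)
  have h12 := h.adj 1 (by omega)
  have h23 := h.adj 2 (by omega)
  have h34 := h.adj 3 (by omega)
  have h45 := h.adj 4 (by omega)
  have h05 := h.adj_last.symm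
  have h02 : ¬ G.Adj (f 0) (f 2) := fun e => by simpa using hc 0 2 (by omega) (by omega) (by omega) e
  have h04 : ¬ G.Adj (f 0) (f 4) := fun e => by simpa using hc 0 4 (by omega) (by omega) (by omega) e
  have h13 : ¬ G.Adj (f 1) (f 3) := fun e => by simpa using hc 1 3 (by omega) (by omega) (by omega) e
  have h15 : ¬ G.Adj (f 1) (f 5) := fun e => by simpa using hc 1 5 (by omega) (by omega) (by omega) e
  have h24 : ¬ G.Adj (f 2) (f 4) := fun e => by simpa using hc 2 4 (by omega) (by omega) (by omega) e
  have h35 : ¬ G.Adj (f 3) (f 5) := fun e => by simpa using hc 3 5 (by omega) (by omega) (by omega) e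
  refine not_isEmpty_iff.2
    (h.nonempty_embedding ![1, 0, 3, 2, 5, 4] (by decide) (by decide) ?_) hdh.2.1
  clear hc
  intro a b
  fin_cases a <;> fin_cases b <;> simp [dominoGraph, *]

/-- Of the three long chords of a 6-cycle, at most one is missing. -/
theorem six_long_chords (h : CycleSeq G 6 f) (hs : Sparse G) (hdh : DistHereditary G) :
    (G.Adj (f 0) (f 3) ∧ G.Adj (f 1) (f 4)) ∨ (G.Adj (f 0) (f 3) ∧ G.Adj (f 2) (f 5)) ∨
      (G.Adj (f 1) (f 4) ∧ G.Adj (f 2) (f 5)) := by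
  have h0 := h.six_adj hs hdh
  have h1 := (h.rotate 1 (by omega)).six_adj hs hdh
  have h2 := (h.rotate 2 (by omega)).six_adj hs hdh
  simp only [Nat.reduceAdd, Nat.reduceLT, Nat.reduceSub, if_true, if_false] at h1 h2
  rw [G.adj_comm (f 3)] at h1 h2
  rw [G.adj_comm (f 4)] at h2
  tauto

theorem eight_not_adj (h : CycleSeq G 8 f) (hs : Sparse G) (hdh : DistHereditary G) :
    ¬ G.Adj (f 0) (f 3) := by
  intro h03
  have h01 := h.adj 0 (by omega)
  have h12 := h.adj 1 (by omega)
  have h23 := h.adj 2 (by omega)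
  have h34 := h.adj 3 (by omega)
  have h45 := h.adj 4 (by omega)
  have h56 := h.adj 5 (by omega)
  have h67 := h.adj 6 (by omega)
  have h07 := h.adj_last.symm
  have key : ∀ p q : ℕ × ℕ, p ≠ q → p.1 < p.2 → p.2 < 8 → q.1 < q.2 → q.2 < 8 →
      G.Adj (f p.1) (f p.2) → G.Adj (f q.1) (f q.2) →
      p ∉ ({(0, 1), (1, 2), (2, 3), (3, 4), (4, 5), (5, 6), (6, 7), (0, 7), (0, 3)} :
        Finset (ℕ × ℕ)) →
      q ∉ ({(0, 1), (1, 2), (2, 3), (3, 4), (4, 5), (5, 6), (6, 7), (0, 7), (0, 3)} :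
        Finset (ℕ × ℕ)) →
      ∀ i j, i < j → j < 8 → G.Adj (f i) (f j) → (i, j) ∈ (insert p (insert q
      {(0, 1), (1, 2), (2, 3), (3, 4), (4, 5), (5, 6), (6, 7), (0, 7), (0, 3)}) :
        Finset (ℕ × ℕ)) := by
    intro p q hpq hp1 hp2 hq1 hq2 hp hq hpm hqm i j hij hj hadj
    refine h.mem_of_card_le hs _ ?_ ?_ hij hj hadj
    · simp only [Finset.forall_mem_insert, Finset.mem_singleton, forall_eq]
      simp [*]
    · rw [Finset.card_insert_of_notMem, Finset.card_insert_of_notMem hqm]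
      · decide
      · rw [Finset.mem_insert]
        tauto
  have hA := (h.outer (i := 0) (j := 3) (by omega) (by omega) (by omega) h03).six_long_chords hs hdh
  simp at hA
  have key05 : G.Adj (f 0) (f 5) → (G.Adj (f 1) (f 4) ∨ G.Adj (f 2) (f 5)) := by
    intro h05
    have := (h.inner (i := 0) (j := 5) (by omega) (by omega) h05).six_long_chords hs hdh
    simp at this
    tauto
  have key36 : G.Adj (f 3) (f 6) → (G.Adj (f 1) (f 6) ∨ G.Adj (f 2) (f 7)) := by
    intro h36
    have := (h.outer (i := 3) (j := 6) (by omega) (by omega) (by omega) h36).six_long_chords hs hdh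
    simp at this
    tauto
  rcases hA with ⟨h05, h36⟩ | ⟨h05, h47⟩ | ⟨h36, h47⟩
  · have := key (0, 5) (3, 6) (by simp) (by simp) (by simp) (by simp) (by simp) h05 h36
      (by simp) (by simp)
    rcases key05 h05 with e | e
    · simpa using this 1 4 (by simp) (by simp) e
    · simpa using this 2 5 (by simp) (by simp) e
  · have := key (0, 5) (4, 7) (by simp) (by simp) (by simp) (by simp) (by simp) h05 h47
      (by simp) (by simp)
    rcases key05 h05 with e | e
    · simpa using this 1 4 (by simp) (by simp) e
    · simpa using this 2 5 (by simp) (by simp) e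
  · have := key (3, 6) (4, 7) (by simp) (by simp) (by simp) (by simp) (by simp) h36 h47
      (by simp) (by simp)
    rcases key36 h36 with e | e
    · simpa using this 1 6 (by simp) (by simp) e
    · simpa using this 2 7 (by simp) (by simp) e

/-- A 6-cycle has a chord joining two vertices at distance 3 along the cycle. -/
theorem six_exists (h : CycleSeq G 6 f) (hs : Sparse G) (hdh : DistHereditary G) :
    ∃ a < 3, G.Adj (f a) (f (a + 3)) := by
  rcases h.six_long_chords hs hdh with ⟨e, -⟩ | ⟨e, -⟩ | ⟨e, -⟩
  exacts [⟨0, by omega, e⟩, ⟨0, by omega, e⟩, ⟨1, by omega, e⟩]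

theorem length_eq (hs : Sparse G) (hdh : DistHereditary G) :
    ∀ {n : ℕ} {f : ℕ → V}, CycleSeq G n f → n = 3 ∨ n = 4 ∨ n = 6 := by
  intro n
  induction n using Nat.strong_induction_on with
  | _ n ih =>
  intro f h
  by_contra hn
  have h3 := h.three_le
  have h5 := h.ne_five hs hdh
  have split : ∀ i j, i + 2 ≤ j → j < n → j - i + 2 ≤ n → G.Adj (f i) (f j) →
      (n = 7 ∧ (j = i + 2 ∨ j = i + 5)) ∨ (n = 8 ∧ (j = i + 3 ∨ j = i + 5)) ∨
        (n = 10 ∧ j = i + 5) := by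
    intro i j hij hj hd hadj
    have h1 := ih _ (by omega) (h.inner hij hj hadj)
    have h2 := ih _ (by omega) (h.outer hij hj hd hadj)
    omega
  have inner_six : ∀ i, i + 5 < n → n ≠ 8 → ¬ G.Adj (f i) (f (i + 5)) := by
    intro i hi h8 hadj
    have h1 := h.inner (by omega) hi hadj
    rw [show i + 5 - i + 1 = 6 by omega] at h1
    obtain ⟨a, ha, e⟩ := h1.six_exists hs hdh
    have := split _ _ (by omega) (by omega) (by omega) e
    omega
  obtain ⟨i, j, hij, hj, hd, hadj⟩ := h.exists_chord (by omega) hdh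
  rcases split i j hij hj hd hadj with ⟨rfl, rfl | rfl⟩ | ⟨rfl, rfl | rfl⟩ | ⟨rfl, rfl⟩
  · have h1 := h.outer hij hj hd hadj
    rw [show 7 - (i + 2 - i) + 1 = 6 by omega] at h1
    obtain ⟨a, ha, e⟩ := h1.six_exists hs hdh
    have := split _ _ (by split_ifs <;> omega) (by split_ifs <;> omega)
      (by split_ifs <;> omega) e
    split_ifs at this <;> omega
  · exact inner_six i hj (by omega) hadj
  · refine (h.rotate i (by omega)).eight_not_adj hs hdh ?_
    simpa [show i < 8 by omega, hj, add_comm 3 i] using hadj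
  · refine (h.rotate (i + 5) hj).eight_not_adj hs hdh ?_
    simpa [hj, show ¬ 3 + (i + 5) < 8 by omega, show 3 + (i + 5) - 8 = i by omega] using hadj.symm
  · exact inner_six i hj (by omega) hadj

theorem image_rotate (a : ℕ) (ha : a < n) :
    (fun k => f (if k + a < n then k + a else k + a - n)) '' Set.Iio n = f '' Set.Iio n := by
  ext x
  constructor
  · rintro ⟨k, hk, rfl⟩
    exact ⟨_, by simp at hk ⊢; split_ifs <;> omega, rfl⟩
  · rintro ⟨k, hk, rfl⟩
    simp only [Set.mem_Iio] at hk
    by_cases hka : a ≤ k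
    · exact ⟨k - a, by simp; omega, by simp [hka, hk]⟩
    · refine ⟨k + n - a, by simp; omega, ?_⟩
      simp [show k + n - a + a = k + n by omega]

theorem iso_triangle (h : CycleSeq G 3 f) :
    Nonempty (G.induce (f '' Set.Iio 3) ≃g triangleGraph) := by
  have h01 := h.adj 0 (by omega)
  have h12 := h.adj 1 (by omega)
  have h02 := h.adj_last.symm
  refine h.nonempty_iso ![0, 1, 2] (by decide) (by decide) (by decide) ?_
  intro a b
  fin_cases a <;> fin_cases b <;> simp [triangleGraph, *]

theorem iso_square (h : CycleSeq G 4 f) (h02 : ¬ G.Adj (f 0) (f 2)) (h13 : ¬ G.Adj (f 1) (f 3)) :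
    Nonempty (G.induce (f '' Set.Iio 4) ≃g SimpleGraph.cycleGraph 4) := by
  have h01 := h.adj 0 (by omega)
  have h12 := h.adj 1 (by omega)
  have h23 := h.adj 2 (by omega)
  have h03 := h.adj_last.symm
  refine h.nonempty_iso ![0, 1, 2, 3] (by decide) (by decide) (by decide) ?_
  intro a b
  fin_cases a <;> fin_cases b <;> simp [SimpleGraph.cycleGraph_adj', *] <;>
    decide

theorem iso_diamond (h : CycleSeq G 4 f) (hs : Sparse G) (h02 : G.Adj (f 0) (f 2)) :
    Nonempty (G.induce (f '' Set.Iio 4) ≃g diamondGraph) := by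
  have h01 := h.adj 0 (by omega)
  have h12 := h.adj 1 (by omega)
  have h23 := h.adj 2 (by omega)
  have h03 := h.adj_last.symm
  have h13 : ¬ G.Adj (f 1) (f 3) := fun e => by
    simpa using h.mem_of_card_le hs {(0, 1), (1, 2), (2, 3), (0, 3), (0, 2)}
      (by simp [*]) (by decide) (i := 1) (j := 3) (by omega) (by omega) e
  refine h.nonempty_iso ![0, 1, 2, 3] (by decide) (by decide) (by decide) ?_
  intro a b
  fin_cases a <;> fin_cases b <;> simp [diamondGraph, *]

theorem iso_K33minus (h : CycleSeq G 6 f) (hs : Sparse G) (hdh : DistHereditary G)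
    (h14 : G.Adj (f 1) (f 4)) (h25 : G.Adj (f 2) (f 5)) :
    Nonempty (G.induce (f '' Set.Iio 6) ≃g K33minus) := by
  have hc := fun i j => h.six_chord hs hdh (i := i) (j := j)
  have h01 := h.adj 0 (by omega)
  have h12 := h.adj 1 (by omega)
  have h23 := h.adj 2 (by omega)
  have h34 := h.adj 3 (by omega)
  have h45 := h.adj 4 (by omega)
  have h05 := h.adj_last.symm
  have h03 : ¬ G.Adj (f 0) (f 3) := fun e => by
    simpa using h.mem_of_card_le hs
      {(0, 1), (1, 2), (2, 3), (3, 4), (4, 5), (0, 5), (1, 4), (2, 5)}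
      (by simp [*]) (by decide) (i := 0) (j := 3) (by omega) (by omega) e
  have h02 : ¬ G.Adj (f 0) (f 2) := fun e => by simpa using hc 0 2 (by omega) (by omega) (by omega) e
  have h04 : ¬ G.Adj (f 0) (f 4) := fun e => by simpa using hc 0 4 (by omega) (by omega) (by omega) e
  have h13 : ¬ G.Adj (f 1) (f 3) := fun e => by simpa using hc 1 3 (by omega) (by omega) (by omega) e
  have h15 : ¬ G.Adj (f 1) (f 5) := fun e => by simpa using hc 1 5 (by omega) (by omega) (by omega) e
  have h24 : ¬ G.Adj (f 2) (f 4) := fun e => by simpa using hc 2 4 (by omega) (by omega) (by omega) e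
  have h35 : ¬ G.Adj (f 3) (f 5) := fun e => by simpa using hc 3 5 (by omega) (by omega) (by omega) e
  refine h.nonempty_iso (Sum.elim ![0, 2, 4] ![3, 1, 5]) (by decide) (by decide) (by decide) ?_
  clear hc
  rintro (a | a) (b | b) <;> fin_cases a <;> fin_cases b <;> simp [K33minus, *]

end CycleSeq

theorem stmt17 {V : Type*} (G : SimpleGraph V) (hdh : DistHereditary G)
    (hs : Sparse G) (v : V) (c : G.Walk v v) (hc : c.IsCycle) :
    Nonempty (G.induce {x | x ∈ c.support} ≃g triangleGraph) ∨
    Nonempty (G.induce {x | x ∈ c.support} ≃g SimpleGraph.cycleGraph 4) ∨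
    Nonempty (G.induce {x | x ∈ c.support} ≃g diamondGraph) ∨
    Nonempty (G.induce {x | x ∈ c.support} ≃g K33minus) := by
  have h := CycleSeq.of_isCycle hc
  have hsupp : {x | x ∈ c.support} = c.getVert '' Set.Iio c.length := by
    have h3 := hc.three_le_length
    ext x
    rw [Set.mem_ofPred_eq, SimpleGraph.Walk.mem_support_iff_exists_getVert]
    constructor
    · rintro ⟨k, rfl, hk⟩
      rcases hk.lt_or_eq with hk | rfl
      · exact ⟨k, hk, rfl⟩
      · exact ⟨0, by simp; omega, by simp⟩
    · rintro ⟨k, hk, rfl⟩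
      exact ⟨k, rfl, le_of_lt hk⟩
  rw [hsupp]
  have hlen := h.length_eq hs hdh
  generalize c.length = n at h hlen
  generalize c.getVert = f at h
  rcases hlen with rfl | rfl | rfl
  · exact Or.inl h.iso_triangle
  · by_cases h02 : G.Adj (f 0) (f 2)
    · exact Or.inr (Or.inr (Or.inl (h.iso_diamond hs h02)))
    by_cases h13 : G.Adj (f 1) (f 3)
    · rw [← CycleSeq.image_rotate 1 (by omega)]
      exact Or.inr (Or.inr (Or.inl ((h.rotate 1 (by omega)).iso_diamond hs h13)))
    · exact Or.inr (Or.inl (h.iso_square h02 h13))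
  · refine Or.inr (Or.inr (Or.inr ?_))
    rcases h.six_long_chords hs hdh with ⟨h03, h14⟩ | ⟨h03, h25⟩ | ⟨h14, h25⟩
    · rw [← CycleSeq.image_rotate 2 (by omega)]
      exact (h.rotate 2 (by omega)).iso_K33minus hs hdh h03.symm h14.symm
    · rw [← CycleSeq.image_rotate 1 (by omega)]
      exact (h.rotate 1 (by omega)).iso_K33minus hs hdh h25 h03.symm
    · exact h.iso_K33minus hs hdh h14 h25
end

section
/- Let G be a 2-connected distance-hereditary graph with at least 3 vertices. Then G is sparse if and only if G is isomorphic to one of: the triangle, the square C₄, the diamond, K_{2,3}, K_{2,4}, or K_{3,3} minus an edge. -/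
open SimpleGraph

section
variable {V W : Type*}

theorem cycleGraph_adj_iff_val {n : ℕ} (hn : 3 ≤ n) (u v : Fin n) :
    (cycleGraph n).Adj u v ↔ u.val + 1 = v.val ∨ v.val + 1 = u.val ∨
      (u.val = 0 ∧ v.val + 1 = n) ∨ (v.val = 0 ∧ u.val + 1 = n) := by
  rw [cycleGraph_adj']
  rcases lt_trichotomy u v with h | h | h
  · rw [Fin.coe_sub_iff_lt.2 h, Fin.coe_sub_iff_le.2 h.le]
    have := Fin.lt_def.1 h
    omega
  · subst h
    rw [Fin.coe_sub_iff_le.2 le_rfl]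
    omega
  · rw [Fin.coe_sub_iff_lt.2 h, Fin.coe_sub_iff_le.2 h.le]
    have := Fin.lt_def.1 h
    omega

/-- The spanning subgraph of `G` keeping only the edges inside `U`. -/
def restrictTo (G : SimpleGraph V) (U : Set V) : SimpleGraph V where
  Adj u v := G.Adj u v ∧ u ∈ U ∧ v ∈ U
  symm := ⟨fun _ _ h => ⟨h.1.symm, h.2.2, h.2.1⟩⟩
  loopless := ⟨fun _ h => h.1.ne rfl⟩

/-- In a graph without holes, an edge `ca` that lies on a cycle through `U ∪ {c}` lies on an
induced triangle or square in `U ∪ {c}`. -/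
theorem exists_triangle_or_square {G : SimpleGraph V}
    (hG : ∀ n : ℕ, 5 ≤ n → IsEmpty (cycleGraph n ↪g G)) {U : Set V} {c a d₀ : V}
    (hca : G.Adj c a) (hcU : c ∉ U) (haU : a ∈ U) (hd₀U : d₀ ∈ U) (hcd₀ : G.Adj c d₀)
    (hd₀a : d₀ ≠ a) (hreach : (restrictTo G U).Reachable a d₀) :
    ∃ d ∈ U, G.Adj c d ∧ d ≠ a ∧
      (G.Adj a d ∨ (¬ G.Adj a d ∧ ∃ e ∈ U, G.Adj a e ∧ G.Adj e d ∧ ¬ G.Adj c e)) := by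
  classical
  set H := restrictTo G U with hH
  have hex : ∃ m, ∃ d ∈ U, G.Adj c d ∧ d ≠ a ∧ H.Reachable a d ∧ H.dist a d = m :=
    ⟨_, d₀, hd₀U, hcd₀, hd₀a, hreach, rfl⟩
  obtain ⟨m, ⟨d, hdU, hcd, hda, hr, hm⟩, hmin⟩ :
      ∃ m, (∃ d ∈ U, G.Adj c d ∧ d ≠ a ∧ H.Reachable a d ∧ H.dist a d = m) ∧
        ∀ k < m, ¬ ∃ d ∈ U, G.Adj c d ∧ d ≠ a ∧ H.Reachable a d ∧ H.dist a d = k :=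
    ⟨Nat.find hex, Nat.find_spec hex, fun k hk => Nat.find_min hex hk⟩
  obtain ⟨p, hp⟩ := hr.exists_walk_length_eq_dist
  rw [hm] at hp
  have hdist : ∀ i ≤ m, H.dist a (p.getVert i) = i := by
    intro i hi
    have h1 : H.dist a (p.getVert i) ≤ i := (dist_le (p.take i)).trans (by simp)
    have h2 : H.dist (p.getVert i) d ≤ m - i := (dist_le (p.drop i)).trans (by simp [hp])
    have h3 := (p.take i).reachable.dist_triangle_left d
    omega
  have hadj : ∀ i < m, H.Adj (p.getVert i) (p.getVert (i + 1)) := fun i hi =>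
    p.adj_getVert_succ (by omega)
  have hU : ∀ i ≤ m, p.getVert i ∈ U := by
    rintro (_ | i) hi
    · simpa using haU
    · exact (hadj i (by omega)).2.2
  have hend : p.getVert m = d := by rw [← hp]; simp
  have hchord : ∀ i ≤ m, ∀ j ≤ m, G.Adj (p.getVert i) (p.getVert j) ↔ (i + 1 = j ∨ j + 1 = i) := by
    intro i hi j hj
    constructor
    · intro h
      have hH' : H.Adj (p.getVert i) (p.getVert j) := ⟨h, hU i hi, hU j hj⟩
      have h1 := hH'.reachable.dist_triangle_right a
      have h2 := hH'.symm.reachable.dist_triangle_right a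
      rw [dist_eq_one_iff_adj.2 hH', hdist i hi, hdist j hj] at h1
      rw [dist_eq_one_iff_adj.2 hH'.symm, hdist i hi, hdist j hj] at h2
      have : i ≠ j := by rintro rfl; exact h.ne rfl
      omega
    · rintro (rfl | rfl)
      · exact (hadj i (by omega)).1
      · exact (hadj j (by omega)).1.symm
  have hc : ∀ i ≤ m, G.Adj c (p.getVert i) ↔ (i = 0 ∨ i = m) := by
    intro i hi
    constructor
    · intro h
      by_contra! hne
      refine hmin i (by omega) ⟨_, hU i hi, h, ?_, (p.take i).reachable, hdist i hi⟩
      intro h0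
      have := hdist i hi
      rw [h0, dist_self] at this
      omega
    · rintro (rfl | rfl)
      · simpa using hca
      · rwa [hend]
  have h0 : p.getVert 0 = a := by simp
  have hm0 : m ≠ 0 := by rintro rfl; exact hda (by rw [← hend, h0])
  refine ⟨d, hdU, hcd, hda, ?_⟩
  rcases (by omega : m = 1 ∨ m = 2 ∨ 3 ≤ m) with h | h | h
  · left
    have := (hchord 0 (by omega) m le_rfl).2 (by omega)
    rwa [h0, hend] at this
  · right
    refine ⟨fun had => ?_, p.getVert 1, hU 1 (by omega), ?_, ?_, ?_⟩
    · have := (hchord 0 (by omega) m le_rfl).1 (by rwa [h0, hend])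
      omega
    · have := (hchord 0 (by omega) 1 (by omega)).2 (by omega)
      rwa [h0] at this
    · have := (hchord 1 (by omega) m (by omega)).2 (by omega)
      rwa [hend] at this
    · rw [hc 1 (by omega)]; omega
  · exfalso
    have hval : ∀ i : Fin (m + 2), ¬ i.val ≤ m → i.val = m + 1 := fun i hi => by omega
    have hcne : ∀ i ≤ m, p.getVert i ≠ c := fun i hi h => hcU (h ▸ hU i hi)
    refine (hG (m + 2) (by omega)).false
      ⟨⟨fun i => if i.val ≤ m then p.getVert i.val else c, ?_⟩, ?_⟩
    · intro i j hij
      apply Fin.ext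
      dsimp only at hij
      split_ifs at hij with hi hj hj
      · rw [← hdist i hi, ← hdist j hj, hij]
      · exact absurd hij (hcne i hi)
      · exact absurd hij.symm (hcne j hj)
      · rw [hval i hi, hval j hj]
    · intro i j
      change G.Adj (if _ then _ else _) (if _ then _ else _) ↔ _
      rw [cycleGraph_adj_iff_val (by omega)]
      split_ifs with hi hj hj
      · rw [hchord i hi j hj]; omega
      · rw [G.adj_comm, hc i hi]; omega
      · rw [hc j hj]; omega
      · simp only [SimpleGraph.irrefl, false_iff]; omega

/-- A map on `Fin n` that is injective and preserves and reflects adjacency, checked on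
increasing pairs only. -/
theorem exists_embedding_of_lt {n : ℕ} {H : SimpleGraph (Fin n)} {G : SimpleGraph V}
    (f : Fin n → V)
    (h : ∀ i j, i < j → f i ≠ f j ∧ (G.Adj (f i) (f j) ↔ H.Adj i j)) : ∃ F : H ↪g G, ⇑F = f := by
  refine ⟨⟨⟨f, fun i j hij => ?_⟩, fun {i j} => ?_⟩, rfl⟩
  · rcases lt_trichotomy i j with hlt | heq | hlt
    · exact absurd hij (h i j hlt).1
    · exact heq
    · exact absurd hij.symm (h j i hlt).1
  · change G.Adj (f i) (f j) ↔ _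
    rcases lt_trichotomy i j with hlt | rfl | hlt
    · exact (h i j hlt).2
    · simp
    · rw [G.adj_comm, H.adj_comm]
      exact (h j i hlt).2

theorem not_house {G : SimpleGraph V} (hG : IsEmpty (houseGraph ↪g G)) {a b c d e : V}
    (hab : G.Adj a b) (hbc : G.Adj b c) (hcd : G.Adj c d) (had : G.Adj a d) (hae : G.Adj a e)
    (hbe : G.Adj b e) (hac : ¬ G.Adj a c) (hbd : ¬ G.Adj b d) (hce : ¬ G.Adj c e)
    (hde : ¬ G.Adj d e) (hac' : a ≠ c) (hbd' : b ≠ d) (hce' : c ≠ e) (hde' : d ≠ e) : False := by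
  have := hab.ne; have := hbc.ne; have := hcd.ne; have := had.ne; have := hae.ne; have := hbe.ne
  obtain ⟨F, -⟩ := exists_embedding_of_lt (H := houseGraph) (G := G) ![a, b, c, d, e] (by
    simp [Fin.forall_fin_succ, houseGraph, *])
  exact hG.false F

theorem not_domino {G : SimpleGraph V} (hG : IsEmpty (dominoGraph ↪g G)) {a b c d e f : V}
    (hab : G.Adj a b) (hbc : G.Adj b c) (hcd : G.Adj c d) (had : G.Adj a d) (hbe : G.Adj b e)
    (hef : G.Adj e f) (hcf : G.Adj c f) (hac : ¬ G.Adj a c) (hae : ¬ G.Adj a e)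
    (haf : ¬ G.Adj a f) (hbd : ¬ G.Adj b d) (hbf : ¬ G.Adj b f) (hce : ¬ G.Adj c e)
    (hde : ¬ G.Adj d e) (hdf : ¬ G.Adj d f) (hac' : a ≠ c) (hae' : a ≠ e) (haf' : a ≠ f)
    (hbd' : b ≠ d) (hbf' : b ≠ f) (hce' : c ≠ e) (hde' : d ≠ e) (hdf' : d ≠ f) : False := by
  have := hab.ne; have := hbc.ne; have := hcd.ne; have := had.ne; have := hbe.ne
  have := hef.ne; have := hcf.ne
  obtain ⟨F, -⟩ := exists_embedding_of_lt (H := dominoGraph) (G := G) ![a, b, c, d, e, f] (by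
    simp [Fin.forall_fin_succ, dominoGraph, *])
  exact hG.false F

theorem nonempty_iso_square {G : SimpleGraph V} {a b c d : V}
    (h : ∀ y, y = a ∨ y = b ∨ y = c ∨ y = d)
    (hab : G.Adj a b) (hbc : G.Adj b c) (hcd : G.Adj c d) (had : G.Adj a d)
    (hac : ¬ G.Adj a c) (hbd : ¬ G.Adj b d) (hac' : a ≠ c) (hbd' : b ≠ d) :
    Nonempty (G ≃g cycleGraph 4) := by
  have := hab.ne; have := hbc.ne; have := hcd.ne; have := had.ne
  obtain ⟨F, hF⟩ := exists_embedding_of_lt (H := cycleGraph 4) (G := G) ![a, b, c, d] (by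
    simp [Fin.forall_fin_succ, cycleGraph_adj_iff_val, *])
  refine ⟨(RelIso.ofSurjective F fun y => ?_).symm⟩
  rw [hF]
  rcases h y with rfl | rfl | rfl | rfl
  exacts [⟨0, rfl⟩, ⟨1, rfl⟩, ⟨2, rfl⟩, ⟨3, rfl⟩]

instance : DecidableRel diamondGraph.Adj := fun u v => by
  unfold diamondGraph
  simp only [fromEdgeSet_adj, Set.mem_insert_iff, Set.mem_singleton_iff]
  infer_instance

instance {m n : ℕ} : DecidableRel (completeBipartiteGraph (Fin m) (Fin n)).Adj := fun u v => by
  simp only [completeBipartiteGraph_adj]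
  infer_instance

instance : DecidableRel K33minus.Adj := fun u v => by
  unfold K33minus
  simp only [fromEdgeSet_adj, Set.mem_ofPred_eq, mem_edgeSet]
  unfold Ne
  infer_instance

instance : DecidableRel triangleGraph.Adj :=
  inferInstanceAs (DecidableRel (⊤ : SimpleGraph (Fin 3)).Adj)

theorem sparse_of_finset [Fintype W] [DecidableEq W] (H : SimpleGraph W) [DecidableRel H.Adj]
    (h : ∀ s : Finset W, s.Nonempty → (H.edgeFinset.filter (· ∈ s.sym2)).card ≤
      3 * s.card / 2 - 1) :
    Sparse H := by
  classical
  intro K hK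
  have h1 := h K.verts.toFinset (by simpa using hK)
  rw [Nat.card_eq_fintype_card (α := K.verts), ← Set.toFinset_card]
  refine le_trans ?_ h1
  rw [Nat.card_coe_set_eq, ← Set.ncard_coe_finset]
  refine Set.ncard_le_ncard ?_ (Finset.finite_toSet _)
  intro e he
  simp only [Finset.coe_filter, Set.mem_ofPred_eq, mem_edgeFinset, Finset.mem_sym2_iff,
    Set.mem_toFinset]
  exact ⟨K.edgeSet_subset he, fun v hv => K.mem_verts_of_mem_edge he hv⟩

theorem Sparse.of_embedding {G : SimpleGraph V} {H : SimpleGraph W} (f : H ↪g G) (hG : Sparse G) :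
    Sparse H := by
  intro K hK
  have hf : Function.Injective f.toHom := f.injective
  have := hG (K.map f.toHom) (by simpa using hK)
  rw [Subgraph.edgeSet_map, Subgraph.map_verts, Nat.card_image_of_injective hf,
    Nat.card_image_of_injective (Sym2.map.injective hf)] at this
  exact this

/-- `H` with a new vertex joined to exactly `i` and `j`. -/
def addVertex (H : SimpleGraph W) (i j : W) : SimpleGraph (Option W) where
  Adj
    | none, none => False
    | none, some w => w = i ∨ w = j
    | some w, none => w = i ∨ w = j
    | some u, some w => H.Adj u w
  symm := ⟨by rintro (_ | u) (_ | w) h <;> first | exact h | exact H.adj_symm h⟩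
  loopless := ⟨by rintro (_ | u) h <;> first | exact h | exact h.ne rfl⟩

instance [DecidableEq W] (H : SimpleGraph W) [DecidableRel H.Adj] (i j : W) :
    DecidableRel (addVertex H i j).Adj
  | none, none => inferInstanceAs (Decidable False)
  | none, some w => inferInstanceAs (Decidable (w = i ∨ w = j))
  | some w, none => inferInstanceAs (Decidable (w = i ∨ w = j))
  | some u, some w => inferInstanceAs (Decidable (H.Adj u w))

theorem nonempty_iso_addVertex {G : SimpleGraph V} {x a b : V} (hax : a ≠ x) (hbx : b ≠ x)
    (hx : ∀ y, G.Adj x y ↔ y = a ∨ y = b) {H : SimpleGraph W}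
    (e : G.comap (Subtype.val : {y // y ≠ x} → V) ≃g H) :
    Nonempty (G ≃g addVertex H (e ⟨a, hax⟩) (e ⟨b, hbx⟩)) := by
  classical
  let f : Option W ≃ V := (Equiv.optionCongr e.toEquiv.symm).trans (Equiv.optionSubtypeNe x)
  refine ⟨Iso.symm ⟨f, ?_⟩⟩
  have key : ∀ (w : W) (c : V) (hc : c ≠ x), (e.symm w : V) = c ↔ w = e ⟨c, hc⟩ := by
    intro w c hc
    constructor
    · rintro rfl; simp
    · rintro rfl; simp
  rintro (_ | u) (_ | w)
  · simp [addVertex]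
  · simp only [f, Equiv.trans_apply, Equiv.optionCongr_apply, Option.map_none, Option.map_some,
      Equiv.optionSubtypeNe_none, Equiv.optionSubtypeNe_some, hx]
    exact or_congr (key _ _ _) (key _ _ _)
  · simp only [f, Equiv.trans_apply, Equiv.optionCongr_apply, Option.map_none, Option.map_some,
      Equiv.optionSubtypeNe_none, Equiv.optionSubtypeNe_some, G.adj_comm _ x, hx]
    exact or_congr (key _ _ _) (key _ _ _)
  · exact e.symm.map_adj_iff

theorem Sparse.card_edgeFinset_le [Fintype V] [Nonempty V] {G : SimpleGraph V} [DecidableRel G.Adj]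
    [Fintype G.edgeSet] (hG : Sparse G) : G.edgeFinset.card ≤ 3 * Fintype.card V / 2 - 1 := by
  have := hG ⊤ (by simp)
  rwa [Subgraph.edgeSet_top, Subgraph.verts_top, Nat.card_eq_fintype_card, ← edgeFinset_card,
    Nat.card_univ, Nat.card_eq_fintype_card] at this

theorem nonempty_iso_of_bijective {G : SimpleGraph V} {H : SimpleGraph W} (f : V → W)
    (hf : Function.Bijective f) (h : ∀ u v, H.Adj (f u) (f v) ↔ G.Adj u v) : Nonempty (G ≃g H) :=
  ⟨⟨Equiv.ofBijective f hf, fun {u v} => h u v⟩⟩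

theorem addVertex_triangle (i j : Fin 3) (hij : i ≠ j) :
    Nonempty (addVertex triangleGraph i j ≃g diamondGraph) :=
  nonempty_iso_of_bijective
    (fun u => u.elim 1 fun k => if k = i then 0 else if k = j then 2 else 3)
    (by revert i j; decide +kernel) (by revert i j; decide +kernel)

theorem addVertex_square (i j : Fin 4) (hij : i ≠ j) (hadj : ¬ (cycleGraph 4).Adj i j) :
    Nonempty (addVertex (cycleGraph 4) i j ≃g completeBipartiteGraph (Fin 2) (Fin 3)) :=
  nonempty_iso_of_bijective
    (fun u => u.elim (.inr 0) fun k =>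
      if k = i then .inl 0 else if k = j then .inl 1 else if k = i + 1 then .inr 1 else .inr 2)
    (by revert i j; decide +kernel) (by revert i j; decide +kernel)

theorem addVertex_K23_inl (i j : Fin 2) (hij : i ≠ j) :
    Nonempty (addVertex (completeBipartiteGraph (Fin 2) (Fin 3)) (.inl i) (.inl j) ≃g
      completeBipartiteGraph (Fin 2) (Fin 4)) :=
  nonempty_iso_of_bijective
    (fun u => u.elim (.inr 0) fun w => w.elim .inl fun k => .inr k.succ)
    (by decide +kernel) (by revert i j; decide +kernel)

theorem addVertex_K23_inr (i j : Fin 3) (hij : i ≠ j) :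
    Nonempty (addVertex (completeBipartiteGraph (Fin 2) (Fin 3)) (.inr i) (.inr j) ≃g K33minus) :=
  nonempty_iso_of_bijective
    (fun u => u.elim (.inl 0) fun w => w.elim (fun k => .inl k.succ) fun k =>
      .inr (if k = i then 1 else if k = j then 2 else 0))
    (by revert i j; decide +kernel) (by revert i j; decide +kernel)

/-- Every edge of `H` lies on an induced square. -/
def EdgesInSquares (H : SimpleGraph W) : Prop :=
  ∀ i j, H.Adj i j → ∃ k l, k ≠ i ∧ l ≠ j ∧ H.Adj j k ∧ H.Adj k l ∧ H.Adj i l ∧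
    ¬ H.Adj i k ∧ ¬ H.Adj j l

theorem edgesInSquares_square : EdgesInSquares (cycleGraph 4) := by
  unfold EdgesInSquares; decide +kernel

theorem edgesInSquares_K23 : EdgesInSquares (completeBipartiteGraph (Fin 2) (Fin 3)) := by
  unfold EdgesInSquares; decide +kernel

theorem not_adj_of_edgesInSquares {G : SimpleGraph V} (hG : IsEmpty (houseGraph ↪g G))
    {H : SimpleGraph W} (hH : EdgesInSquares H) {i j : W} (e : G ≃g addVertex H i j) :
    ¬ H.Adj i j := by
  intro hij
  obtain ⟨k, l, hki, hlj, hjk, hkl, hil, hik, hjl⟩ := hH i j hij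
  have hH : IsEmpty (houseGraph ↪g addVertex H i j) :=
    ⟨fun f => hG.false (f.trans e.symm.toEmbedding)⟩
  refine not_house hH (a := some i) (b := some j) (c := some k) (d := some l) (e := none)
    hij hjk hkl hil (Or.inl rfl) (Or.inr rfl) hik hjl ?_ ?_ ?_ ?_ ?_ ?_
  · rintro (rfl | rfl)
    exacts [hki rfl, hjk.ne rfl]
  · rintro (rfl | rfl)
    exacts [hil.ne rfl, hlj rfl]
  · simpa using hki.symm
  · simpa using hlj.symm
  · simp
  · simp

/-- `G` has no cut vertex: after deleting any vertex `v`, there is an edge across every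
nontrivial bipartition. -/
def NoCutVertex (G : SimpleGraph V) : Prop :=
  ∀ (v : V) (S : Set V), v ∉ S → S.Nonempty → (∃ y, y ∉ S ∧ y ≠ v) →
    ∃ s ∈ S, ∃ t, t ∉ S ∧ t ≠ v ∧ G.Adj s t

theorem TwoConnected.noCutVertex {G : SimpleGraph V} (h : TwoConnected G) : NoCutVertex G := by
  rintro v S hvS ⟨s, hs⟩ ⟨y, hy, hyv⟩
  have hsv : s ≠ v := fun h => hvS (h ▸ hs)
  obtain ⟨p⟩ := (h.2.2 v).preconnected ⟨s, by simp [hsv]⟩ ⟨y, by simp [hyv]⟩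
  obtain ⟨d, -, h1, h2⟩ := p.exists_boundary_dart (Subtype.val ⁻¹' S) hs hy
  have h3 := d.snd.2
  simp only [Subgraph.deleteVerts_verts, Subgraph.verts_top, Set.mem_sdiff, Set.mem_univ, true_and,
    Set.mem_singleton_iff] at h3
  exact ⟨_, h1, _, h2, h3, Subgraph.coe_adj_sub _ _ _ d.adj⟩

theorem NoCutVertex.exists_adj_ne {G : SimpleGraph V} (h : NoCutVertex G) {x y z : V}
    (hxy : x ≠ y) (hzx : z ≠ x) (hzy : z ≠ y) : ∃ t, t ≠ y ∧ G.Adj x t := by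
  obtain ⟨s, rfl, t, -, hty, hst⟩ := h y {x} (by simpa using hxy.symm) ⟨x, rfl⟩ ⟨z, by simpa, hzy⟩
  exact ⟨t, hty, hst⟩

theorem Sparse.exists_two_neighbors [Fintype V] {G : SimpleGraph V} (hG : Sparse G)
    (h : NoCutVertex G) (hV : 3 ≤ Fintype.card V) :
    ∃ x a b, a ≠ b ∧ ∀ y, G.Adj x y ↔ y = a ∨ y = b := by
  classical
  have : Nonempty V := Fintype.card_pos_iff.1 (by omega)
  have hthird : ∀ u v : V, ∃ z, z ≠ u ∧ z ≠ v := by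
    intro u v
    obtain ⟨z, hz⟩ := Finset.exists_mem_notMem_of_card_lt_card (s := {u, v}) (t := Finset.univ)
      (Finset.card_le_two.trans_lt (by rw [Finset.card_univ]; omega))
    exact ⟨z, by simpa using hz⟩
  obtain ⟨x, hx⟩ : ∃ x, G.degree x ≤ 2 := by
    by_contra! hdeg
    have h1 := Finset.card_nsmul_le_sum Finset.univ (fun v => G.degree v) 3 fun v _ => hdeg v
    rw [G.sum_degrees_eq_twice_card_edges, smul_eq_mul, Finset.card_univ] at h1
    have := hG.card_edgeFinset_le
    omega
  obtain ⟨y, hyx, -⟩ := hthird x x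
  obtain ⟨z, hzx, hzy⟩ := hthird x y
  obtain ⟨a, -, hxa⟩ := h.exists_adj_ne hyx.symm hzx hzy
  obtain ⟨w, hwx, hwa⟩ := hthird x a
  obtain ⟨b, hba, hxb⟩ := h.exists_adj_ne hxa.ne hwx hwa
  refine ⟨x, a, b, hba.symm, fun y => ⟨fun hy => ?_, ?_⟩⟩
  · have hsub : ({a, b} : Finset V) ⊆ G.neighborFinset x := by
      simp [Finset.insert_subset_iff, hxa, hxb]
    have heq := Finset.eq_of_subset_of_card_le hsub (by
      rw [G.card_neighborFinset_eq_degree, Finset.card_pair hba.symm]; exact hx)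
    have : y ∈ G.neighborFinset x := by simpa using hy
    simpa [← heq] using this
  · rintro (rfl | rfl) <;> assumption

theorem eq_singleton_of_square {G : SimpleGraph V} (hdh : DistHereditary G) (h : NoCutVertex G)
    {S : Set V} {x a b c : V} (hab : a ≠ b) (hx : ∀ y, G.Adj x y ↔ y = a ∨ y = b)
    (hca : G.Adj c a) (hcb : G.Adj c b) (hcx : c ≠ x)
    (haS : a ∈ S) (hbS : b ∉ S) (hcS : c ∉ S) (hxS : x ∉ S)
    (hS : ∀ s ∈ S, ∀ t, G.Adj s t → t ∈ S ∨ t = c ∨ t = x) : S = {a} := by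
  obtain ⟨hhouse, hdomino, -, hhole⟩ := hdh
  have hxa : G.Adj x a := (hx a).2 (Or.inl rfl)
  have hxb : G.Adj x b := (hx b).2 (Or.inr rfl)
  have hxc : ¬ G.Adj x c := by
    rw [hx]; exact not_or.2 ⟨hca.ne, hcb.ne⟩
  have hxS' : ∀ s ∈ S, s ≠ a → ¬ G.Adj x s := by
    intro s hs hsa
    rw [hx]; exact not_or.2 ⟨hsa, fun h => hbS (h ▸ hs)⟩
  have hbS' : ∀ s ∈ S, ¬ G.Adj s b := by
    intro s hs hsb
    rcases hS s hs b hsb with h | h | h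
    exacts [hbS h, hcb.ne h.symm, hxb.ne h.symm]
  have hneS : ∀ {y}, y ∉ S → ∀ s ∈ S, y ≠ s := fun hy s hs h => hy (h ▸ hs)
  have hno : ¬ ∃ d ∈ S, G.Adj c d ∧ d ≠ a ∧ (restrictTo G S).Reachable a d := by
    rintro ⟨d₀, hd₀S, hcd₀, hd₀a, hr⟩
    obtain ⟨d, hdS, hcd, hda, had | ⟨had, e, heS, hae, hed, hce⟩⟩ :=
      exists_triangle_or_square hhole hca hcS haS hd₀S hcd₀ hd₀a hr
    · exact not_house hhouse hca.symm hcb hxb.symm hxa.symm had hcd (hbS' a haS)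
        (fun h => hxc h.symm) (fun h => hbS' d hdS h.symm) (hxS' d hdS hda) hab hcx
        (hneS hbS d hdS) (hneS hxS d hdS)
    · exact not_domino hdomino hxa hca.symm hcb hxb hae hed hcd hxc (hxS' e heS hae.ne')
        (hxS' d hdS hda) (hbS' a haS) had hce (fun h => hbS' e heS h.symm)
        (fun h => hbS' d hdS h.symm) hcx.symm (hneS hxS e heS) (hneS hxS d hdS) hab hda.symm
        (hneS hcS e heS) (hneS hbS e heS) (hneS hbS d hdS)
  set R : Set V := {v | v ∈ S ∧ v ≠ a ∧ (restrictTo G S).Reachable a v} with hR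
  have hRe : R = ∅ := by
    by_contra hne
    obtain ⟨s, ⟨hsS, hsa, hr⟩, t, htR, hta, hst⟩ := h a R (fun h => h.2.1 rfl)
      (Set.nonempty_iff_ne_empty.2 hne) ⟨x, fun h => hxS h.1, hxa.ne⟩
    rcases hS s hsS t hst with ht | rfl | rfl
    · exact htR ⟨ht, hta, hr.trans (Adj.reachable ⟨hst, hsS, ht⟩)⟩
    · exact hno ⟨s, hsS, hst.symm, hsa, hr⟩
    · exact hxS' s hsS hsa hst.symm
  by_contra hSa
  have hne : (S \ {a}).Nonempty := by
    rw [Set.sdiff_nonempty, Set.subset_singleton_iff_eq]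
    rintro (rfl | h)
    exacts [haS, hSa h]
  obtain ⟨s, ⟨hsS, hsa⟩, t, htS, htc, hst⟩ := h c (S \ {a}) (fun h => hcS h.1) hne
    ⟨x, fun h => hxS h.1, hcx.symm⟩
  rcases hS s hsS t hst with ht | ht | rfl
  · obtain rfl : t = a := by
      by_contra hta
      exact htS ⟨ht, hta⟩
    exact (hRe ▸ (⟨hsS, hsa, Adj.reachable ⟨hst.symm, ht, hsS⟩⟩ : s ∈ R) : s ∈ (∅ : Set V))
  · exact htc ht
  · exact hxS' s hsS hsa hst.symm

theorem nonempty_iso_square_of_separation {G : SimpleGraph V} (hdh : DistHereditary G)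
    (h : NoCutVertex G) {S : Set V} {x a b c : V} (hab : a ≠ b)
    (hx : ∀ y, G.Adj x y ↔ y = a ∨ y = b) (hcx : c ≠ x) (hbc : b ≠ c)
    (haS : a ∈ S) (hbS : b ∉ S) (hcS : c ∉ S) (hxS : x ∉ S)
    (hS : ∀ s ∈ S, ∀ t, G.Adj s t → t ∈ S ∨ t = c ∨ t = x) : Nonempty (G ≃g cycleGraph 4) := by
  have hxa : G.Adj x a := (hx a).2 (Or.inl rfl)
  have hxb : G.Adj x b := (hx b).2 (Or.inr rfl)
  have hnab : ¬ G.Adj a b := by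
    intro hadj
    rcases hS a haS b hadj with h | h | h
    exacts [hbS h, hbc h, hxb.ne h.symm]
  have hr : (restrictTo G {x}ᶜ).Reachable a b := by
    by_contra hnr
    obtain ⟨s, ⟨hsx, hs⟩, t, ht, htx, hst⟩ := h x
      {v | v ≠ x ∧ (restrictTo G {x}ᶜ).Reachable a v} (fun h => h.1 rfl)
      ⟨a, hxa.ne', Reachable.refl a⟩ ⟨b, fun h => hnr h.2, hxb.ne'⟩
    exact ht ⟨htx, hs.trans (Adj.reachable ⟨hst, hsx, htx⟩)⟩
  obtain ⟨hca, hcb⟩ : G.Adj c a ∧ G.Adj c b := by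
    obtain ⟨d, -, hxd, hda, hd⟩ := exists_triangle_or_square hdh.2.2.2 hxa (by simp) hxa.ne'
      hxb.ne' hxb hab.symm hr
    obtain rfl := ((hx d).1 hxd).resolve_left hda
    obtain ⟨-, e, hex, hae, hed, -⟩ := hd.resolve_left hnab
    rcases hS a haS e hae with he | rfl | rfl
    · rcases hS e he d hed with h | h | h
      exacts [absurd h hbS, absurd h hbc, absurd h hxb.ne']
    · exact ⟨hae.symm, hed⟩
    · exact absurd rfl hex
  have hSa := eq_singleton_of_square hdh h hab hx hca hcb hcx haS hbS hcS hxS hS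
  have hTb := eq_singleton_of_square (S := {y | y ∉ S ∧ y ≠ c ∧ y ≠ x}) hdh h hab.symm
    (fun y => (hx y).trans or_comm) hcb hca hcx ⟨hbS, hbc, hxb.ne'⟩ (fun h => h.1 haS)
    (fun h => h.2.1 rfl) (fun h => h.2.2 rfl) (by
      rintro s ⟨hsS, hsc, hsx⟩ t hst
      by_contra! hcon
      have ht : t ∈ S := by
        by_contra ht
        exact hcon.1 ⟨ht, hcon.2⟩
      rcases hS t ht s hst.symm with h | h | h
      exacts [hsS h, hsc h, hsx h])
  refine nonempty_iso_square (a := x) (b := a) (c := c) (d := b) (fun y => ?_) hxa hca.symm hcb hxb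
    ?_ hnab hcx.symm hab
  · by_contra! hy
    have hyT : y ∈ {y | y ∉ S ∧ y ≠ c ∧ y ≠ x} := ⟨by simpa [hSa] using hy.2.1, hy.2.2.1, hy.1⟩
    rw [hTb] at hyT
    exact hy.2.2.2 hyT
  · rw [hx]; exact not_or.2 ⟨hca.ne, hcb.ne⟩

theorem noCutVertex_or_nonempty_iso_square {G : SimpleGraph V} (hdh : DistHereditary G)
    (h : NoCutVertex G) {x a b : V} (hab : a ≠ b) (hx : ∀ y, G.Adj x y ↔ y = a ∨ y = b) :
    NoCutVertex (G.comap (Subtype.val : {y // y ≠ x} → V)) ∨ Nonempty (G ≃g cycleGraph 4) := by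
  refine or_iff_not_imp_left.2 fun hcut => ?_
  unfold NoCutVertex at hcut
  push Not at hcut
  obtain ⟨⟨c, hcx⟩, S, hcS, ⟨s₀, hs₀⟩, ⟨⟨y, hyx⟩, hyS, hyc⟩, hS⟩ := hcut
  have hyc' : y ≠ c := fun h => hyc (Subtype.ext h)
  set S' : Set V := Subtype.val '' S with hS'
  have hmem : ∀ {v} (hv : v ≠ x), v ∈ S' ↔ (⟨v, hv⟩ : {y // y ≠ x}) ∈ S := by
    intro v hv; simp [hS', hv]
  have hxS' : x ∉ S' := by simp [hS']
  have hcS' : c ∉ S' := by rwa [hmem hcx]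
  have hyS' : y ∉ S' := by rwa [hmem hyx]
  have hsep : ∀ s ∈ S', ∀ t, G.Adj s t → t ∈ S' ∨ t = c ∨ t = x := by
    rintro _ ⟨s, hs, rfl⟩ t hst
    by_contra! hcon
    refine hS s hs ⟨t, hcon.2.2⟩ (by rw [← hmem]; exact hcon.1) ?_ hst
    exact fun h => hcon.2.1 (congrArg Subtype.val h)
  obtain ⟨s, hs, t, ht, htc, hst⟩ := h c S' hcS' ⟨s₀, s₀, hs₀, rfl⟩ ⟨y, hyS', hyc'⟩
  obtain rfl : t = x := by
    rcases hsep s hs t hst with h | h | h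
    exacts [absurd h ht, absurd h htc, h]
  obtain ⟨u, hu, w, hw, hwc, huw⟩ := h c (insert t S') (by simp [hcx, hcS']) ⟨t, by simp⟩
    ⟨y, by simp [hyx, hyS'], hyc'⟩
  rw [Set.mem_insert_iff, not_or] at hw
  obtain rfl : u = t := by
    refine hu.resolve_right fun hu' => ?_
    rcases hsep u hu' w huw with h | h | h
    exacts [hw.2 h, hwc h, hw.1 h]
  have hsw : s ≠ w := fun h => hw.2 (h ▸ hs)
  refine nonempty_iso_square_of_separation hdh h (S := S') (a := s) (b := w) hsw ?_ hcx hwc hs hw.2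
    hcS' hxS' hsep
  intro z
  rw [hx]
  have h1 := (hx s).1 hst.symm
  have h2 := (hx w).1 huw
  rcases h1 with rfl | rfl <;> rcases h2 with rfl | rfl
  · exact absurd rfl hsw
  · rfl
  · exact or_comm
  · exact absurd rfl hsw

theorem DistHereditary.of_embedding {G : SimpleGraph V} {H : SimpleGraph W} (f : H ↪g G)
    (hG : DistHereditary G) : DistHereditary H :=
  ⟨⟨fun g => hG.1.false (g.trans f)⟩, ⟨fun g => hG.2.1.false (g.trans f)⟩,
    ⟨fun g => hG.2.2.1.false (g.trans f)⟩, fun n hn => ⟨fun g => (hG.2.2.2 n hn).false (g.trans f)⟩⟩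

theorem not_sparse_of_card_lt [Fintype W] [Nonempty W] {G : SimpleGraph V} {H : SimpleGraph W}
    [DecidableRel H.Adj] [Fintype H.edgeSet]
    (hH : 3 * Fintype.card W / 2 - 1 < H.edgeFinset.card) (e : G ≃g H) : ¬ Sparse G :=
  fun hG => hH.not_ge (hG.of_embedding e.symm.toEmbedding).card_edgeFinset_le

theorem card_edgeFinset_addVertex_diamond : ∀ i j, i ≠ j →
    3 * Fintype.card (Option (Fin 4)) / 2 - 1 <
      (addVertex diamondGraph i j).edgeFinset.card := by
  decide +kernel

theorem card_edgeFinset_addVertex_K24 : ∀ i j, i ≠ j →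
    3 * Fintype.card (Option (Fin 2 ⊕ Fin 4)) / 2 - 1 <
      (addVertex (completeBipartiteGraph (Fin 2) (Fin 4)) i j).edgeFinset.card := by
  decide +kernel

theorem card_edgeFinset_addVertex_K33minus : ∀ i j, i ≠ j →
    3 * Fintype.card (Option (Fin 3 ⊕ Fin 3)) / 2 - 1 <
      (addVertex K33minus i j).edgeFinset.card := by
  decide +kernel

/-- `G` is one of the six sparse 2-connected distance-hereditary graphs. -/
def IsSparseBlock (G : SimpleGraph V) : Prop :=
  Nonempty (G ≃g triangleGraph) ∨ Nonempty (G ≃g SimpleGraph.cycleGraph 4) ∨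
    Nonempty (G ≃g diamondGraph) ∨
    Nonempty (G ≃g completeBipartiteGraph (Fin 2) (Fin 3)) ∨
    Nonempty (G ≃g completeBipartiteGraph (Fin 2) (Fin 4)) ∨
    Nonempty (G ≃g K33minus)

theorem IsSparseBlock.sparse {G : SimpleGraph V} (hG : IsSparseBlock G) : Sparse G := by
  rcases hG with ⟨⟨e⟩⟩ | ⟨⟨e⟩⟩ | ⟨⟨e⟩⟩ | ⟨⟨e⟩⟩ | ⟨⟨e⟩⟩ | ⟨⟨e⟩⟩ <;>
    exact .of_embedding e.toEmbedding (sparse_of_finset _ (by decide +kernel))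

theorem IsSparseBlock.of_addVertex {G : SimpleGraph V} (hdh : DistHereditary G) (hG : Sparse G)
    {x a b : V} (hab : a ≠ b) (hx : ∀ y, G.Adj x y ↔ y = a ∨ y = b)
    (h : IsSparseBlock (G.comap (Subtype.val : {y // y ≠ x} → V))) : IsSparseBlock G := by
  have hax : a ≠ x := ((hx a).2 (Or.inl rfl)).ne'
  have hbx : b ≠ x := ((hx b).2 (Or.inr rfl)).ne'
  have hab' : (⟨a, hax⟩ : {y // y ≠ x}) ≠ ⟨b, hbx⟩ := fun h => hab (congrArg Subtype.val h)
  rcases h with ⟨⟨e⟩⟩ | ⟨⟨e⟩⟩ | ⟨⟨e⟩⟩ | ⟨⟨e⟩⟩ | ⟨⟨e⟩⟩ | ⟨⟨e⟩⟩ <;>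
    obtain ⟨f⟩ := nonempty_iso_addVertex hax hbx hx e <;>
    have hij := e.injective.ne hab' <;>
    generalize e ⟨a, hax⟩ = i at f hij <;> generalize e ⟨b, hbx⟩ = j at f hij
  · obtain ⟨g⟩ := addVertex_triangle i j hij
    exact .inr (.inr (.inl ⟨f.trans g⟩))
  · obtain ⟨g⟩ := addVertex_square i j hij
      (not_adj_of_edgesInSquares hdh.1 edgesInSquares_square f)
    exact .inr (.inr (.inr (.inl ⟨f.trans g⟩)))
  · exact absurd hG (not_sparse_of_card_lt (card_edgeFinset_addVertex_diamond i j hij) f)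
  · have hadj := not_adj_of_edgesInSquares hdh.1 edgesInSquares_K23 f
    rcases i with i | i <;> rcases j with j | j
    · obtain ⟨g⟩ := addVertex_K23_inl i j (fun h => hij (congrArg _ h))
      exact .inr (.inr (.inr (.inr (.inl ⟨f.trans g⟩))))
    · simp at hadj
    · simp at hadj
    · obtain ⟨g⟩ := addVertex_K23_inr i j (fun h => hij (congrArg _ h))
      exact .inr (.inr (.inr (.inr (.inr ⟨f.trans g⟩))))
  · exact absurd hG (not_sparse_of_card_lt (card_edgeFinset_addVertex_K24 i j hij) f)
  · exact absurd hG (not_sparse_of_card_lt (card_edgeFinset_addVertex_K33minus i j hij) f)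

theorem nonempty_iso_triangle [Fintype V] {G : SimpleGraph V} (h : NoCutVertex G)
    (hV : Fintype.card V = 3) : Nonempty (G ≃g triangleGraph) := by
  classical
  have hG : G = ⊤ := by
    ext u w
    refine ⟨fun h => h.ne, fun huw => ?_⟩
    obtain ⟨v, hv⟩ := Finset.exists_mem_notMem_of_card_lt_card (s := {u, w}) (t := Finset.univ)
      (Finset.card_le_two.trans_lt (by rw [Finset.card_univ]; omega))
    simp only [Finset.mem_univ, Finset.mem_insert, Finset.mem_singleton, not_or, true_and] at hv
    obtain ⟨t, htv, hut⟩ := h.exists_adj_ne (Ne.symm hv.1) huw.symm (Ne.symm hv.2)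
    have huniv : ({u, w, v} : Finset V) = Finset.univ := by
      rw [← Finset.card_eq_iff_eq_univ, hV, Finset.card_eq_three]
      exact ⟨u, w, v, huw, Ne.symm hv.1, Ne.symm hv.2, rfl⟩
    have ht : t ∈ ({u, w, v} : Finset V) := huniv ▸ Finset.mem_univ t
    simp only [Finset.mem_insert, Finset.mem_singleton, htv, or_false, hut.ne', false_or] at ht
    rwa [ht] at hut
  subst hG
  exact ⟨Iso.completeGraph (Fintype.equivFinOfCardEq hV)⟩

theorem isSparseBlock_of_noCutVertex [Fintype V] {G : SimpleGraph V} (hdh : DistHereditary G)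
    (h : NoCutVertex G) (hV : 3 ≤ Fintype.card V) (hG : Sparse G) : IsSparseBlock G := by
  classical
  obtain ⟨n, hn⟩ : ∃ n, Fintype.card V = n + 3 := ⟨_, (Nat.sub_add_cancel hV).symm⟩
  clear hV
  induction n generalizing V with
  | zero => exact .inl (nonempty_iso_triangle h hn)
  | succ n ih =>
    obtain ⟨x, a, b, hab, hx⟩ := hG.exists_two_neighbors h (by omega)
    let f : G.comap (Subtype.val : {y // y ≠ x} → V) ↪g G :=
      Embedding.comap (Function.Embedding.subtype _) G
    rcases noCutVertex_or_nonempty_iso_square hdh h hab hx with hcut | hsq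
    · refine .of_addVertex hdh hG hab hx (ih (hdh.of_embedding f) hcut (hG.of_embedding f) ?_)
      rw [Fintype.card_subtype_compl, Fintype.card_subtype_eq]
      omega
    · exact .inr (.inl hsq)

end

theorem stmt18 {V : Type*} (G : SimpleGraph V) (hdh : DistHereditary G)
    (h2 : TwoConnected G) (h3 : 3 ≤ Nat.card V) :
    Sparse G ↔
      Nonempty (G ≃g triangleGraph) ∨ Nonempty (G ≃g SimpleGraph.cycleGraph 4) ∨
      Nonempty (G ≃g diamondGraph) ∨
      Nonempty (G ≃g completeBipartiteGraph (Fin 2) (Fin 3)) ∨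
      Nonempty (G ≃g completeBipartiteGraph (Fin 2) (Fin 4)) ∨
      Nonempty (G ≃g K33minus) := by
  have : Finite V := Nat.finite_of_card_ne_zero (by omega)
  have := Fintype.ofFinite V
  exact ⟨isSparseBlock_of_noCutVertex hdh h2.noCutVertex (by rwa [← Nat.card_eq_fintype_card]),
    IsSparseBlock.sparse⟩
end
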